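/- Let X be a proper CAT(0) space and Y ⊆ X a closed convex subset such that ∂Y has intrinsic circumradius strictly greater than π/2 with respect to the Tits angle metric. Then there exists a closed convex subset Z ⊆ X with ∂Z = ∂Y that is minimal among closed convex subsets with this property. Moreover the union Z_0 of all such minimal subsets is closed and convex and is isometric to a product Z × Z' in which the fibres Z × {z'} are exactly the minimal closed convex subsets with boundary ∂Y. -/

import Mathlib

open Metric Set Filter

universe u v

variable {X : Type u}

/-- An affinely parametrised geodesic segment from `x` to `y`, defined on `[0,1]`. -/
def IsGeodesicSeg [MetricSpace X] (x y : X) (γ : ℝ → X) : Prop :=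
  γ 0 = x ∧ γ 1 = y ∧
    ∀ s ∈ Set.Icc (0:ℝ) 1, ∀ t ∈ Set.Icc (0:ℝ) 1, dist (γ s) (γ t) = |s - t| * dist x y

/-- A CAT(0) space: a geodesic metric space in which every geodesic triangle is at least as
thin as its Euclidean comparison triangle, expressed via the standard comparison
(convexity) inequality along geodesics. -/
class CAT0Space (X : Type u) [MetricSpace X] : Prop where
  exists_geodesic : ∀ x y : X, ∃ γ : ℝ → X, IsGeodesicSeg x y γ
  comparison : ∀ (p x y : X) (γ : ℝ → X), IsGeodesicSeg x y γ → ∀ t ∈ Set.Icc (0:ℝ) 1,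
    dist p (γ t) ^ 2 ≤ (1 - t) * dist p x ^ 2 + t * dist p y ^ 2 - t * (1 - t) * dist x y ^ 2

/-- A subset is (geodesically) convex if it contains every geodesic segment between
any two of its points. -/
def GeoConvex [MetricSpace X] (C : Set X) : Prop :=
  ∀ x ∈ C, ∀ y ∈ C, ∀ γ : ℝ → X, IsGeodesicSeg x y γ → ∀ t ∈ Set.Icc (0:ℝ) 1, γ t ∈ C

/-- Every geodesic segment of positive length extends to a locally isometric embedding
of the whole real line. -/
def GeodesicallyComplete (X : Type u) [MetricSpace X] : Prop :=
  ∀ x y : X, x ≠ y → ∀ γ : ℝ → X, IsGeodesicSeg x y γ →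
    ∃ ℓ : ℝ → X,
      (∀ t : ℝ, ∃ ε > (0:ℝ), ∀ s₁ ∈ Set.Ioo (t - ε) (t + ε), ∀ s₂ ∈ Set.Ioo (t - ε) (t + ε),
        dist (ℓ s₁) (ℓ s₂) = |s₁ - s₂|) ∧
      ∀ t ∈ Set.Icc (0:ℝ) 1, ℓ (t * dist x y) = γ t

/-- A (unit speed) geodesic ray, parametrised by `[0,∞)`. -/
structure GeodesicRay (X : Type u) [MetricSpace X] where
  toFun : ℝ → X
  isom : ∀ s, 0 ≤ s → ∀ t, 0 ≤ t → dist (toFun s) (toFun t) = |s - t|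

/-- Two rays are asymptotic if they remain at bounded distance. -/
def GeodesicRay.Asymp [MetricSpace X] (ρ σ : GeodesicRay X) : Prop :=
  ∃ C : ℝ, ∀ t, 0 ≤ t → dist (ρ.toFun t) (σ.toFun t) ≤ C

theorem GeodesicRay.asymp_equivalence (X : Type u) [MetricSpace X] :
    Equivalence (GeodesicRay.Asymp (X := X)) where
  refl ρ := ⟨0, fun t _ => by simp⟩
  symm := fun {ρ σ} ⟨C, hC⟩ => ⟨C, fun t ht => by rw [dist_comm]; exact hC t ht⟩
  trans := fun {ρ σ τ} ⟨C₁, h₁⟩ ⟨C₂, h₂⟩ =>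
    ⟨C₁ + C₂, fun t ht => (dist_triangle (ρ.toFun t) (σ.toFun t) (τ.toFun t)).trans
      (add_le_add (h₁ t ht) (h₂ t ht))⟩

instance GeodesicRay.setoid (X : Type u) [MetricSpace X] : Setoid (GeodesicRay X) :=
  ⟨GeodesicRay.Asymp, GeodesicRay.asymp_equivalence X⟩

/-- The boundary at infinity: asymptote classes of geodesic rays. -/
def Boundary (X : Type u) [MetricSpace X] : Type u := Quotient (GeodesicRay.setoid X)

/-- The boundary point determined by a ray. -/
def GeodesicRay.cls [MetricSpace X] (ρ : GeodesicRay X) : Boundary X := Quotient.mk _ ρ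

/-- The boundary at infinity of a subset `Y ⊆ X`: classes of rays staying within
bounded distance of `Y`. -/
def boundarySet [MetricSpace X] (Y : Set X) : Set (Boundary X) :=
  {ξ | ∃ ρ : GeodesicRay X, ρ.cls = ξ ∧ ∃ C : ℝ, ∀ t, 0 ≤ t → ∃ y ∈ Y, dist (ρ.toFun t) y ≤ C}

/-- Composition of a ray with an isometric map. -/
def GeodesicRay.comp [MetricSpace X] (f : X → X) (hf : Isometry f) (ρ : GeodesicRay X) :
    GeodesicRay X :=
  ⟨fun t => f (ρ.toFun t), fun s hs t ht => by simpa [hf.dist_eq] using ρ.isom s hs t ht⟩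

/-- The induced map of an isometric map on the boundary at infinity. -/
def Boundary.map [MetricSpace X] (f : X → X) (hf : Isometry f) : Boundary X → Boundary X :=
  Quotient.map (GeodesicRay.comp f hf)
    (fun ρ σ h => by
      obtain ⟨C, hC⟩ := h
      exact ⟨C, fun t ht => by simpa [GeodesicRay.comp, hf.dist_eq] using hC t ht⟩)

/-- The Euclidean comparison angle at `p` of the points `x, y`. -/
noncomputable def cmpAngle [MetricSpace X] (p x y : X) : ℝ :=
  Real.arccos ((dist p x ^ 2 + dist p y ^ 2 - dist x y ^ 2) / (2 * dist p x * dist p y))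

/-- The Alexandrov angle between two geodesic rays issuing from the same point
(in a CAT(0) space, the comparison angles are monotone, so the limit defining the
Alexandrov angle is the infimum of comparison angles). -/
noncomputable def alexAngleRays [MetricSpace X] (ρ σ : ℝ → X) : ℝ :=
  sInf {a | ∃ s, 0 < s ∧ ∃ t, 0 < t ∧ a = cmpAngle (ρ 0) (ρ s) (σ t)}

/-- The Alexandrov angle between two geodesic segments (parametrised on `[0,1]`)
issuing from the same point. -/
noncomputable def alexAngleSegs [MetricSpace X] (γ δ : ℝ → X) : ℝ :=
  sInf {a | ∃ s ∈ Set.Ioc (0:ℝ) 1, ∃ t ∈ Set.Ioc (0:ℝ) 1, a = cmpAngle (γ 0) (γ s) (δ t)}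

/-- The Tits angle between two boundary points: the supremum over basepoints of the
Alexandrov angle between the rays issuing from that basepoint representing them. -/
noncomputable def titsAngle [MetricSpace X] (ξ η : Boundary X) : ℝ :=
  sSup {a | ∃ ρ σ : GeodesicRay X, ρ.toFun 0 = σ.toFun 0 ∧ ρ.cls = ξ ∧ σ.cls = η ∧
    a = alexAngleRays ρ.toFun σ.toFun}

/-- The circumradius of `Z` within `Y`, with respect to the distance function `d`. -/
noncomputable def circumradiusIn {B : Type v} (d : B → B → ℝ) (Y Z : Set B) : ℝ :=
  sInf ((fun y => sSup ((fun z => d y z) '' Z)) '' Y)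

/-- The topology of the Tits boundary, generated by the balls of the Tits angle metric. -/
instance boundaryTopology (X : Type u) [MetricSpace X] : TopologicalSpace (Boundary X) :=
  TopologicalSpace.generateFrom
    {U | ∃ (ξ : Boundary X) (r : ℝ), U = {η | titsAngle ξ η < r}}

/-- Lebesgue covering dimension of a subset `K` is at most `n`: every open cover of `K`
admits an open refinement covering `K` of multiplicity at most `n+1` on `K`. -/
def CovDimSubsetLE {B : Type v} [TopologicalSpace B] (K : Set B) (n : ℕ) : Prop :=
  ∀ 𝒰 : Set (Set B), (∀ U ∈ 𝒰, IsOpen U) → K ⊆ ⋃₀ 𝒰 →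
    ∃ 𝒱 : Set (Set B), (∀ V ∈ 𝒱, IsOpen V) ∧ K ⊆ ⋃₀ 𝒱 ∧
      (∀ V ∈ 𝒱, ∃ U ∈ 𝒰, V ⊆ U) ∧
      ∀ x ∈ K, {V | V ∈ 𝒱 ∧ x ∈ V}.Finite ∧ {V | V ∈ 𝒱 ∧ x ∈ V}.ncard ≤ n + 1

/-- The Tits boundary is finite-dimensional: the topological dimension of compact
subsets of the Tits boundary is bounded. -/
def FiniteDimTitsBoundary (X : Type u) [MetricSpace X] : Prop :=
  ∃ n : ℕ, ∀ K : Set (Boundary X), IsCompact K → CovDimSubsetLE K n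

/-- The topology of uniform convergence on compacta (compact-open topology) on the
isometry group of `X`. -/
instance isomEquivTopology (X : Type u) [MetricSpace X] : TopologicalSpace (X ≃ᵢ X) :=
  TopologicalSpace.induced (fun g : X ≃ᵢ X => (⟨⇑g, g.continuous⟩ : C(X, X)))
    ContinuousMap.compactOpen

/-- A subgroup of the isometry group acts minimally: there is no nonempty proper closed
convex invariant subset. -/
def MinimalSubgroupAction [MetricSpace X] (G : Subgroup (X ≃ᵢ X)) : Prop :=
  ∀ C : Set X, C.Nonempty → IsClosed C → GeoConvex C →
    (∀ g ∈ G, ∀ x ∈ C, g x ∈ C) → C = Set.univ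

section SMulNotions
variable {G : Type v} [Group G] [MulAction G X] [MetricSpace X]

/-- The translation length of `g`. -/
noncomputable def transLength (g : G) : ℝ := sInf (Set.range fun x : X => dist (g • x) x)

/-- `g` acts as an elliptic isometry: it fixes a point. -/
def IsEllipticSMul (g : G) : Prop := ∃ x : X, g • x = x

/-- `g` acts as a hyperbolic isometry: its translation length is positive and attained. -/
def IsHyperbolicSMul (g : G) : Prop :=
  ∃ x : X, dist (g • x) x = transLength (X := X) g ∧ 0 < dist (g • x) x

end SMulNotions

/-- The Busemann function associated with a geodesic ray, based at `ρ 0`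
(the limit exists, hence agrees with the `limsup`). -/
noncomputable def busemann [MetricSpace X] (ρ : GeodesicRay X) (y : X) : ℝ :=
  Filter.limsup (fun t : ℝ => dist (ρ.toFun t) y - dist (ρ.toFun t) (ρ.toFun 0)) Filter.atTop

/-- Convergence of a sequence to a boundary point in the cône topology (in a CAT(0)
space): the sequence escapes to infinity and the geodesics from the basepoint `p` to the
points of the sequence converge pointwise to the ray from `p` representing `η`. -/
def SeqTendstoBoundary [MetricSpace X] (p : X) (u : ℕ → X) (η : Boundary X) : Prop :=
  Filter.Tendsto (fun n => dist p (u n)) Filter.atTop Filter.atTop ∧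
  ∃ σ : GeodesicRay X, σ.toFun 0 = p ∧ σ.cls = η ∧
    ∀ γ : ℕ → ℝ → X, (∀ n, IsGeodesicSeg p (u n) (γ n)) →
      ∀ t, 0 ≤ t →
        Filter.Tendsto (fun n => γ n (t / dist p (u n))) Filter.atTop (nhds (σ.toFun t))

/-- The closed convex hull of a subset. -/
def closedGeoConvexHull [MetricSpace X] (S : Set X) : Set X :=
  ⋂₀ {C : Set X | IsClosed C ∧ GeoConvex C ∧ S ⊆ C}

/-- A real function is convex if its restriction to every geodesic is convex. -/
def ConvexFun [MetricSpace X] (f : X → ℝ) : Prop :=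
  ∀ (x y : X) (γ : ℝ → X), IsGeodesicSeg x y γ →
    ∀ s ∈ Set.Icc (0:ℝ) 1, ∀ t ∈ Set.Icc (0:ℝ) 1, ∀ a b : ℝ, 0 ≤ a → 0 ≤ b → a + b = 1 →
      f (γ (a * s + b * t)) ≤ a * f (γ s) + b * f (γ t)

/-- `X` is boundary-minimal: no proper closed convex subset has full boundary. -/
def BoundaryMinimal (X : Type u) [MetricSpace X] : Prop :=
  ∀ Y : Set X, IsClosed Y → GeoConvex Y → boundarySet Y = boundarySet (Set.univ : Set X) →
    Y = Set.univ

/-- A geodesic segment with respect to an abstract distance function `d`. -/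
def IsGeodesicSegD {B : Type v} (d : B → B → ℝ) (x y : B) (γ : ℝ → B) : Prop :=
  γ 0 = x ∧ γ 1 = y ∧
    ∀ s ∈ Set.Icc (0:ℝ) 1, ∀ t ∈ Set.Icc (0:ℝ) 1, d (γ s) (γ t) = |s - t| * d x y

/-- Convexity with respect to an abstract distance function `d`. -/
def DConvex {B : Type v} (d : B → B → ℝ) (A : Set B) : Prop :=
  ∀ x ∈ A, ∀ y ∈ A, ∀ γ : ℝ → B, IsGeodesicSegD d x y γ → ∀ t ∈ Set.Icc (0:ℝ) 1, γ t ∈ A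

/-- `X` is irreducible: it admits no isometric splitting as an (ℓ²-)product with both
factors containing more than one point. -/
def IrreducibleCAT0 (X : Type u) [MetricSpace X] : Prop :=
  ¬ ∃ (A : Type u) (B : Type u) (_ : MetricSpace A) (_ : MetricSpace B)
      (_ : X ≃ᵢ WithLp 2 (A × B)), Nontrivial A ∧ Nontrivial B

/-- The forward ray of a geodesic line. -/
def GeodesicRay.ofLineFwd [MetricSpace X] (ℓ : ℝ → X)
    (h : ∀ s t : ℝ, dist (ℓ s) (ℓ t) = |s - t|) : GeodesicRay X :=
  ⟨ℓ, fun s _ t _ => h s t⟩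

/-- The backward ray of a geodesic line. -/
def GeodesicRay.ofLineBwd [MetricSpace X] (ℓ : ℝ → X)
    (h : ∀ s t : ℝ, dist (ℓ s) (ℓ t) = |s - t|) : GeodesicRay X :=
  ⟨fun t => ℓ (-t), fun s _ t _ => by
    rw [h (-s) (-t), show (-s) - (-t) = -(s - t) by ring, abs_neg]⟩

/-- Two boundary points are opposite if they are the two endpoints of a geodesic line. -/
def OppositeBd [MetricSpace X] (ξ η : Boundary X) : Prop :=
  ∃ (ℓ : ℝ → X) (h : ∀ s t : ℝ, dist (ℓ s) (ℓ t) = |s - t|),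
    (GeodesicRay.ofLineBwd ℓ h).cls = ξ ∧ (GeodesicRay.ofLineFwd ℓ h).cls = η

/-- An isometry is parabolic if its displacement function does not attain its infimum. -/
def IsParabolicIsom [MetricSpace X] (g : X ≃ᵢ X) : Prop :=
  ¬ ∃ x : X, dist (g x) x = sInf (Set.range fun y : X => dist (g y) y)

/-- The fixed-point set of an isometry in the boundary at infinity. -/
def boundaryFixedSet [MetricSpace X] (g : X ≃ᵢ X) : Set (Boundary X) :=
  {ξ | Boundary.map (⇑g) g.isometry ξ = ξ}


/-- `Z` is a minimal closed convex subset with the same boundary as `Y`. -/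
def MinimalFullSub (X : Type u) [MetricSpace X] (Y Z : Set X) : Prop :=
  IsClosed Z ∧ GeoConvex Z ∧ boundarySet Z = boundarySet Y ∧
    ∀ W : Set X, IsClosed W → GeoConvex W → boundarySet W = boundarySet Y → W ⊆ Z → W = Z

section Segments
variable [MetricSpace X] {x y : X} {γ : ℝ → X} {t : ℝ}

theorem IsGeodesicSeg.dist_left (h : IsGeodesicSeg x y γ) (ht : t ∈ Set.Icc (0 : ℝ) 1) :
    dist x (γ t) = t * dist x y := by
  obtain ⟨h0, -, h⟩ := h
  have := h 0 (by simp) t ht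
  rw [h0] at this
  rw [this, zero_sub, abs_neg, abs_of_nonneg ht.1]

theorem IsGeodesicSeg.dist_right (h : IsGeodesicSeg x y γ) (ht : t ∈ Set.Icc (0 : ℝ) 1) :
    dist (γ t) y = (1 - t) * dist x y := by
  obtain ⟨-, h1, h⟩ := h
  have := h t ht 1 (by simp)
  rw [h1] at this
  rw [this, abs_sub_comm, abs_of_nonneg (by linarith [ht.2])]

theorem IsGeodesicSeg.symm (h : IsGeodesicSeg x y γ) : IsGeodesicSeg y x fun t => γ (1 - t) := by
  obtain ⟨h0, h1, h2⟩ := h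
  refine ⟨by simpa, by simpa, fun s hs t ht => ?_⟩
  rw [h2 _ ⟨by linarith [hs.2], by linarith [hs.1]⟩ _ ⟨by linarith [ht.2], by linarith [ht.1]⟩,
    dist_comm y x, abs_sub_comm]
  congr 2
  ring

theorem isGeodesicSeg_const (x : X) : IsGeodesicSeg x x fun _ => x :=
  ⟨rfl, rfl, fun _ _ _ _ => by simp⟩

theorem IsGeodesicSeg.map_of_dist_eq (h : IsGeodesicSeg x y γ) {S : Set X} {f : X → X}
    (hf : ∀ u ∈ S, ∀ v ∈ S, dist (f u) (f v) = dist u v)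
    (hS : ∀ t ∈ Set.Icc (0 : ℝ) 1, γ t ∈ S) : IsGeodesicSeg (f x) (f y) (fun t => f (γ t)) := by
  have hx : x ∈ S := h.1 ▸ hS 0 (by simp)
  have hy : y ∈ S := h.2.1 ▸ hS 1 (by simp)
  refine ⟨by simp [h.1], by simp [h.2.1], fun s hs t ht => ?_⟩
  rw [hf _ (hS s hs) _ (hS t ht), hf _ hx _ hy, h.2.2 s hs t ht]

theorem GeodesicRay.isGeodesicSeg (ρ : GeodesicRay X) {T : ℝ} (hT : 0 ≤ T) :
    IsGeodesicSeg (ρ.toFun 0) (ρ.toFun T) (fun t => ρ.toFun (t * T)) := by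
  refine ⟨by simp, by simp, fun s hs t ht => ?_⟩
  rw [ρ.isom _ (mul_nonneg hs.1 hT) _ (mul_nonneg ht.1 hT), ρ.isom _ le_rfl _ hT, ← sub_mul,
    abs_mul, zero_sub, abs_neg]

variable [CAT0Space X]

theorem IsGeodesicSeg.eq_of_dist_le (h : IsGeodesicSeg x y γ) (ht : t ∈ Set.Icc (0 : ℝ) 1) {m : X}
    (hx : dist m x ≤ t * dist x y) (hy : dist m y ≤ (1 - t) * dist x y) : m = γ t := by
  have key := CAT0Space.comparison m x y γ h t ht
  have hx2 : dist m x ^ 2 ≤ (t * dist x y) ^ 2 := pow_le_pow_left₀ dist_nonneg hx 2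
  have hy2 : dist m y ^ 2 ≤ ((1 - t) * dist x y) ^ 2 := pow_le_pow_left₀ dist_nonneg hy 2
  have h1 := mul_le_mul_of_nonneg_left hx2 (sub_nonneg.2 ht.2)
  have h2 := mul_le_mul_of_nonneg_left hy2 ht.1
  have h3 : dist m (γ t) ^ 2 ≤ 0 := by nlinarith
  have h4 : dist m (γ t) = 0 := by
    have := sq_nonneg (dist m (γ t))
    exact pow_eq_zero_iff (two_ne_zero) |>.1 (le_antisymm h3 this)
  exact dist_eq_zero.1 h4

theorem IsGeodesicSeg.eq_of_isGeodesicSeg (h : IsGeodesicSeg x y γ) {δ : ℝ → X}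
    (h' : IsGeodesicSeg x y δ) (ht : t ∈ Set.Icc (0 : ℝ) 1) : δ t = γ t :=
  h.eq_of_dist_le ht (by rw [dist_comm, h'.dist_left ht]) (by rw [h'.dist_right ht])

/-- The four point inequality of Reshetnyak. -/
theorem CAT0Space.dist_sq_add_dist_sq_le (a b c d : X) :
    dist a c ^ 2 + dist b d ^ 2 ≤
      dist a d ^ 2 + dist b c ^ 2 + 2 * dist a b * dist c d := by
  obtain ⟨γ, hγ⟩ := CAT0Space.exists_geodesic a c
  have weighted : ∀ p q : ℝ, 0 < p → 0 < q →
      p * q * (dist a c ^ 2 + dist b d ^ 2) ≤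
        p * q * (dist a d ^ 2 + dist b c ^ 2) + q ^ 2 * dist a b ^ 2 + p ^ 2 * dist c d ^ 2 := by
    intro p q hp hq
    have hpq : 0 < p + q := add_pos hp hq
    have ht : p / (p + q) ∈ Set.Icc (0 : ℝ) 1 :=
      ⟨by positivity, (div_le_one hpq).2 (by linarith)⟩
    have h1 := CAT0Space.comparison b a c γ hγ _ ht
    have h2 := CAT0Space.comparison d a c γ hγ _ ht
    set m := γ (p / (p + q))
    have e : 1 - p / (p + q) = q / (p + q) := by field_simp; ring
    rw [e] at h1 h2
    have h3 := dist_triangle b m d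
    rw [dist_comm m d] at h3
    rw [dist_comm b a] at h1
    rw [dist_comm d a, dist_comm d c] at h2
    have h1' : (p + q) ^ 2 * dist b m ^ 2 ≤
        (p + q) * q * dist a b ^ 2 + (p + q) * p * dist b c ^ 2 - p * q * dist a c ^ 2 := by
      calc _ ≤ (p + q) ^ 2 * _ := mul_le_mul_of_nonneg_left h1 (by positivity)
        _ = _ := by field_simp
    have h2' : (p + q) ^ 2 * dist d m ^ 2 ≤
        (p + q) * q * dist a d ^ 2 + (p + q) * p * dist c d ^ 2 - p * q * dist a c ^ 2 := by
      calc _ ≤ (p + q) ^ 2 * _ := mul_le_mul_of_nonneg_left h2 (by positivity)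
        _ = _ := by field_simp
    have h4 : dist b d ^ 2 ≤ (dist b m + dist d m) ^ 2 := pow_le_pow_left₀ dist_nonneg h3 2
    have h5 : p * q * (dist b m + dist d m) ^ 2 ≤
        (p + q) * (q * dist b m ^ 2 + p * dist d m ^ 2) := by
      nlinarith [sq_nonneg (q * dist b m - p * dist d m)]
    have h6 : (p + q) * (p * q * dist b d ^ 2) ≤
        (p + q) ^ 2 * (q * dist b m ^ 2 + p * dist d m ^ 2) := by
      have := mul_le_mul_of_nonneg_left h4 (mul_pos hp hq).le
      nlinarith
    have h7 : (p + q) * (p * q * (dist a c ^ 2 + dist b d ^ 2)) ≤ (p + q) *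
        (p * q * (dist a d ^ 2 + dist b c ^ 2) + q ^ 2 * dist a b ^ 2 + p ^ 2 * dist c d ^ 2) := by
      have h8 := mul_le_mul_of_nonneg_left h1' hq.le
      have h9 := mul_le_mul_of_nonneg_left h2' hp.le
      nlinarith
    exact le_of_mul_le_mul_left h7 hpq
  have lim : Tendsto (fun ε : ℝ => (dist a b + ε) * (dist c d + ε) *
        (dist a d ^ 2 + dist b c ^ 2 - (dist a c ^ 2 + dist b d ^ 2)) +
        (dist c d + ε) ^ 2 * dist a b ^ 2 + (dist a b + ε) ^ 2 * dist c d ^ 2)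
      (nhdsWithin 0 (Set.Ioi 0)) (nhds ((dist a b + 0) * (dist c d + 0) *
        (dist a d ^ 2 + dist b c ^ 2 - (dist a c ^ 2 + dist b d ^ 2)) +
        (dist c d + 0) ^ 2 * dist a b ^ 2 + (dist a b + 0) ^ 2 * dist c d ^ 2)) :=
    (Continuous.tendsto (by fun_prop) 0).mono_left nhdsWithin_le_nhds
  have hlim := ge_of_tendsto lim (b := 0) (by
    filter_upwards [self_mem_nhdsWithin] with ε hε
    have hε : 0 < ε := hε
    nlinarith [weighted (dist a b + ε) (dist c d + ε) (add_pos_of_nonneg_of_pos dist_nonneg hε)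
      (add_pos_of_nonneg_of_pos dist_nonneg hε)])
  rcases eq_or_lt_of_le (dist_nonneg (x := a) (y := b)) with hab | hab
  · have : a = b := dist_eq_zero.1 hab.symm
    subst this
    simp [add_comm]
  rcases eq_or_lt_of_le (dist_nonneg (x := c) (y := d)) with hcd | hcd
  · have : c = d := dist_eq_zero.1 hcd.symm
    subst this
    simp
  have h8 : 0 ≤ (dist a b * dist c d) * (dist a d ^ 2 + dist b c ^ 2 -
      (dist a c ^ 2 + dist b d ^ 2) + 2 * dist a b * dist c d) := by
    nlinarith
  have := nonneg_of_mul_nonneg_right h8 (mul_pos hab hcd)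
  linarith

/-- Convexity of the metric. -/
theorem IsGeodesicSeg.dist_le {x' y' : X} {δ : ℝ → X} (h : IsGeodesicSeg x y γ)
    (h' : IsGeodesicSeg x' y' δ) (ht : t ∈ Set.Icc (0 : ℝ) 1) :
    dist (γ t) (δ t) ≤ (1 - t) * dist x x' + t * dist y y' := by
  have common : ∀ {p u v : X} {α β : ℝ → X} {t : ℝ}, IsGeodesicSeg p u α → IsGeodesicSeg p v β →
      t ∈ Set.Icc (0 : ℝ) 1 → dist (α t) (β t) ≤ t * dist u v := by
    intro p u v α β t hα hβ ht
    have h1 := CAT0Space.comparison (β t) p u α hα t ht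
    have h2 := CAT0Space.comparison u p v β hβ t ht
    rw [dist_comm (β t) p, hβ.dist_left ht, dist_comm (β t) u] at h1
    rw [dist_comm u p] at h2
    have h3 := mul_le_mul_of_nonneg_left h2 ht.1
    rw [dist_comm]
    refine abs_le_of_sq_le_sq' ?_ (mul_nonneg ht.1 dist_nonneg) |>.2
    nlinarith
  obtain ⟨α, hα⟩ := CAT0Space.exists_geodesic x y'
  have h1 := common h hα ht
  have ht' : 1 - t ∈ Set.Icc (0 : ℝ) 1 := ⟨by linarith [ht.2], by linarith [ht.1]⟩
  have h2 := common hα.symm h'.symm ht'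
  simp only [sub_sub_cancel] at h2
  linarith [dist_triangle (γ t) (α t) (δ t)]

theorem GeoConvex.dist_sq_add_dist_sq_le {C : Set X} (hC : GeoConvex C) {p q y : X} (hq : q ∈ C)
    (hmin : ∀ z ∈ C, dist p q ≤ dist p z) (hy : y ∈ C) :
    dist p q ^ 2 + dist q y ^ 2 ≤ dist p y ^ 2 := by
  obtain ⟨γ, hγ⟩ := CAT0Space.exists_geodesic q y
  have lim : Tendsto (fun t : ℝ => dist p q ^ 2 + (1 - t) * dist q y ^ 2)
      (nhdsWithin 0 (Set.Ioi 0)) (nhds (dist p q ^ 2 + (1 - 0) * dist q y ^ 2)) :=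
    (Continuous.tendsto (by fun_prop) 0).mono_left nhdsWithin_le_nhds
  have := le_of_tendsto lim (b := dist p y ^ 2) (by
    filter_upwards [Ioo_mem_nhdsGT (show (0 : ℝ) < 1 by norm_num)] with t ht
    have ht' : t ∈ Set.Icc (0 : ℝ) 1 := ⟨ht.1.le, ht.2.le⟩
    have h1 := CAT0Space.comparison p q y γ hγ t ht'
    have h2 : dist p q ^ 2 ≤ dist p (γ t) ^ 2 :=
      pow_le_pow_left₀ dist_nonneg (hmin _ (hC q hq y hy γ hγ t ht')) 2
    have h3 : t * (dist p q ^ 2 + (1 - t) * dist q y ^ 2) ≤ t * dist p y ^ 2 := by nlinarith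
    exact le_of_mul_le_mul_left h3 ht.1)
  linarith

end Segments

section Projections
variable [MetricSpace X]

/-- A point of `C` nearest to `x` (and `x` itself if there is none). -/
noncomputable def nearestPt (C : Set X) (x : X) : X :=
  open Classical in if h : ∃ y ∈ C, Metric.infDist x C = dist x y then h.choose else x

variable [ProperSpace X] {C : Set X}

theorem nearestPt_spec (hcl : IsClosed C) (hne : C.Nonempty) (x : X) :
    nearestPt C x ∈ C ∧ Metric.infDist x C = dist x (nearestPt C x) := by
  have h := hcl.exists_infDist_eq_dist hne x
  unfold nearestPt
  rw [dif_pos h]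
  exact h.choose_spec

theorem nearestPt_mem (hcl : IsClosed C) (hne : C.Nonempty) (x : X) : nearestPt C x ∈ C :=
  (nearestPt_spec hcl hne x).1

theorem dist_nearestPt (hcl : IsClosed C) (hne : C.Nonempty) (x : X) :
    dist x (nearestPt C x) = Metric.infDist x C :=
  (nearestPt_spec hcl hne x).2.symm

theorem dist_nearestPt_le (hcl : IsClosed C) (x : X) {y : X} (hy : y ∈ C) :
    dist x (nearestPt C x) ≤ dist x y := by
  rw [dist_nearestPt hcl ⟨y, hy⟩]
  exact Metric.infDist_le_dist_of_mem hy

variable [CAT0Space X]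

theorem nearestPt_dist_sq_le (hcl : IsClosed C) (hC : GeoConvex C) (x : X) {y : X} (hy : y ∈ C) :
    dist x (nearestPt C x) ^ 2 + dist (nearestPt C x) y ^ 2 ≤ dist x y ^ 2 :=
  hC.dist_sq_add_dist_sq_le (nearestPt_mem hcl ⟨y, hy⟩ x)
    (fun _ hz => dist_nearestPt_le hcl x hz) hy

theorem eq_nearestPt (hcl : IsClosed C) (hC : GeoConvex C) {x y : X} (hy : y ∈ C)
    (hxy : dist x y ≤ Metric.infDist x C) : nearestPt C x = y := by
  have h1 := nearestPt_dist_sq_le hcl hC x hy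
  rw [dist_nearestPt hcl ⟨y, hy⟩] at h1
  have h2 : dist x y ^ 2 ≤ Metric.infDist x C ^ 2 := pow_le_pow_left₀ dist_nonneg hxy 2
  have h3 : dist (nearestPt C x) y ^ 2 ≤ 0 := by linarith
  exact dist_eq_zero.1 (pow_eq_zero_iff two_ne_zero |>.1 (le_antisymm h3 (sq_nonneg _)))

theorem dist_nearestPt_nearestPt_le (hcl : IsClosed C) (hC : GeoConvex C) (hne : C.Nonempty)
    (x y : X) : dist (nearestPt C x) (nearestPt C y) ≤ dist x y := by
  have h1 := nearestPt_dist_sq_le hcl hC x (nearestPt_mem hcl hne y)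
  have h2 := nearestPt_dist_sq_le hcl hC y (nearestPt_mem hcl hne x)
  have h3 := CAT0Space.dist_sq_add_dist_sq_le x y (nearestPt C y) (nearestPt C x)
  rw [dist_comm (nearestPt C y) (nearestPt C x)] at h2 h3
  rcases eq_or_lt_of_le (dist_nonneg (x := nearestPt C x) (y := nearestPt C y)) with h0 | h0
  · rw [← h0]; exact dist_nonneg
  · have : dist (nearestPt C x) (nearestPt C y) * dist (nearestPt C x) (nearestPt C y) ≤
        dist (nearestPt C x) (nearestPt C y) * dist x y := by nlinarith
    exact le_of_mul_le_mul_left this h0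

theorem infDist_seg_le (hcl : IsClosed C) (hC : GeoConvex C) (hne : C.Nonempty) {x y : X}
    {γ : ℝ → X} (hγ : IsGeodesicSeg x y γ) {t : ℝ} (ht : t ∈ Set.Icc (0 : ℝ) 1) :
    Metric.infDist (γ t) C ≤ (1 - t) * Metric.infDist x C + t * Metric.infDist y C := by
  obtain ⟨δ, hδ⟩ := CAT0Space.exists_geodesic (nearestPt C x) (nearestPt C y)
  have h := hγ.dist_le hδ ht
  rw [dist_nearestPt hcl hne, dist_nearestPt hcl hne] at h
  exact (Metric.infDist_le_dist_of_mem (hC _ (nearestPt_mem hcl hne x) _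
    (nearestPt_mem hcl hne y) δ hδ t ht)).trans h

end Projections

section Rays
variable [MetricSpace X]

theorem GeodesicRay.cls_eq_of_bounded {ρ σ : GeodesicRay X} {C : ℝ}
    (hC : ∀ t, 0 ≤ t → dist (ρ.toFun t) (σ.toFun t) ≤ C) : ρ.cls = σ.cls :=
  Quotient.sound ⟨C, hC⟩

theorem boundarySet_mono {V W : Set X} (h : V ⊆ W) : boundarySet V ⊆ boundarySet W := by
  rintro ξ ⟨ρ, hρ, C, hC⟩
  refine ⟨ρ, hρ, C, fun t ht => ?_⟩
  obtain ⟨y, hy, hd⟩ := hC t ht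
  exact ⟨y, h hy, hd⟩

theorem boundarySet_subset_of_dist_le {V W : Set X} {K : ℝ}
    (h : ∀ v ∈ V, ∃ w ∈ W, dist v w ≤ K) : boundarySet V ⊆ boundarySet W := by
  rintro ξ ⟨ρ, hρ, C, hC⟩
  refine ⟨ρ, hρ, C + K, fun t ht => ?_⟩
  obtain ⟨y, hy, hd⟩ := hC t ht
  obtain ⟨w, hw, hd'⟩ := h y hy
  exact ⟨w, hw, (dist_triangle _ y _).trans (add_le_add hd hd')⟩

theorem nonempty_of_boundarySet_nonempty {W : Set X} (h : (boundarySet W).Nonempty) :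
    W.Nonempty := by
  obtain ⟨ξ, ρ, -, C, hC⟩ := h
  obtain ⟨y, hy, -⟩ := hC 0 le_rfl
  exact ⟨y, hy⟩

theorem exists_tendsto_hyperfilter_of_dist_le [ProperSpace X] {u : ℕ → X} {x : X} {r : ℝ}
    (h : ∀ᶠ n in atTop, dist (u n) x ≤ r) :
    ∃ z, Tendsto u (hyperfilter ℕ : Filter ℕ) (nhds z) := by
  obtain ⟨z, -, hz⟩ := (isCompact_closedBall x r).ultrafilter_le_nhds'
    ((hyperfilter ℕ).map u) (by
      rw [Ultrafilter.mem_map]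
      exact Nat.hyperfilter_le_atTop h)
  exact ⟨z, hz⟩

theorem exists_limit_ray [ProperSpace X] (x : X) (y : ℕ → X)
    (hy : Tendsto (fun n => dist x (y n)) atTop atTop) (γ : ℕ → ℝ → X)
    (hγ : ∀ n, IsGeodesicSeg x (y n) (γ n)) :
    ∃ ρ : GeodesicRay X, ρ.toFun 0 = x ∧ ∀ s, 0 ≤ s →
      Tendsto (fun n => γ n (s / dist x (y n))) (hyperfilter ℕ : Filter ℕ)
        (nhds (ρ.toFun s)) := by
  have hmem : ∀ s, 0 ≤ s → ∀ᶠ n in atTop, s / dist x (y n) ∈ Set.Icc (0 : ℝ) 1 := by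
    intro s hs
    filter_upwards [hy.eventually_ge_atTop s, hy.eventually_gt_atTop 0] with n h1 h2
    exact ⟨by positivity, (div_le_one h2).2 h1⟩
  have hex : ∀ s, ∃ z, 0 ≤ s → Tendsto (fun n => γ n (s / dist x (y n)))
      (hyperfilter ℕ : Filter ℕ) (nhds z) := by
    intro s
    by_cases hs : 0 ≤ s
    · obtain ⟨z, hz⟩ := exists_tendsto_hyperfilter_of_dist_le
        (u := fun n => γ n (s / dist x (y n))) (x := x) (r := s) (by
        filter_upwards [hmem s hs, hy.eventually_gt_atTop 0] with n h1 h2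
        rw [dist_comm, (hγ n).dist_left h1, div_mul_cancel₀ _ h2.ne'])
      exact ⟨z, fun _ => hz⟩
    · exact ⟨x, fun h => absurd h hs⟩
  choose f hf using hex
  refine ⟨⟨f, fun s hs t ht => ?_⟩, ?_, hf⟩
  · refine tendsto_nhds_unique ((hf s hs).dist (hf t ht)) ?_
    refine Tendsto.congr' ?_ tendsto_const_nhds
    apply Nat.hyperfilter_le_atTop
    filter_upwards [hmem s hs, hmem t ht, hy.eventually_gt_atTop 0] with n h1 h2 h3
    rw [(hγ n).2.2 _ h1 _ h2, ← sub_div, abs_div, abs_of_pos h3, div_mul_cancel₀ _ h3.ne']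
  · refine tendsto_nhds_unique (hf 0 le_rfl) ?_
    simp only [zero_div, (hγ _).1]
    exact tendsto_const_nhds

variable [CAT0Space X]

theorem GeodesicRay.dist_le_of_bounded (ρ σ : GeodesicRay X) {C : ℝ}
    (hC : ∀ t, 0 ≤ t → dist (ρ.toFun t) (σ.toFun t) ≤ C) {s : ℝ} (hs : 0 ≤ s) :
    dist (ρ.toFun s) (σ.toFun s) ≤ dist (ρ.toFun 0) (σ.toFun 0) := by
  have lim : Tendsto (fun T : ℝ => (1 - s / T) * dist (ρ.toFun 0) (σ.toFun 0) + s / T * C) atTop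
      (nhds ((1 - 0) * dist (ρ.toFun 0) (σ.toFun 0) + 0 * C)) := by
    have h : Tendsto (fun T : ℝ => s / T) atTop (nhds 0) := tendsto_const_nhds.div_atTop tendsto_id
    exact ((tendsto_const_nhds.sub h).mul_const _).add (h.mul_const _)
  have := ge_of_tendsto lim (b := dist (ρ.toFun s) (σ.toFun s)) (by
    filter_upwards [eventually_ge_atTop s, eventually_gt_atTop 0] with T hT hT0
    have ht : s / T ∈ Set.Icc (0 : ℝ) 1 := ⟨by positivity, (div_le_one hT0).2 hT⟩
    have h := (ρ.isGeodesicSeg hT0.le).dist_le (σ.isGeodesicSeg hT0.le) ht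
    simp only [div_mul_cancel₀ _ hT0.ne'] at h
    refine h.trans ?_
    gcongr
    exact hC T hT0.le)
  linarith

theorem GeodesicRay.dist_le_of_cls_eq {ρ σ : GeodesicRay X} (h : ρ.cls = σ.cls) {s : ℝ}
    (hs : 0 ≤ s) : dist (ρ.toFun s) (σ.toFun s) ≤ dist (ρ.toFun 0) (σ.toFun 0) := by
  obtain ⟨C, hC⟩ := Quotient.exact h
  exact ρ.dist_le_of_bounded σ hC hs

variable [ProperSpace X]

/-- A closed convex set contains a ray from each of its points to each of its boundary points. -/
theorem exists_ray_mem {W : Set X} (hcl : IsClosed W) (hcv : GeoConvex W) {x : X} (hx : x ∈ W)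
    {ξ : Boundary X} (hξ : ξ ∈ boundarySet W) :
    ∃ ρ : GeodesicRay X, ρ.toFun 0 = x ∧ ρ.cls = ξ ∧ ∀ s, 0 ≤ s → ρ.toFun s ∈ W := by
  obtain ⟨ρ, rfl, C, hC⟩ := hξ
  choose y hyW hyC using fun n : ℕ => hC n n.cast_nonneg
  choose γ hγ using fun n => CAT0Space.exists_geodesic x (y n)
  have hlow : ∀ n : ℕ, |dist x (y n) - n| ≤ dist (ρ.toFun 0) x + C := by
    intro n
    have h1 := ρ.isom 0 le_rfl n n.cast_nonneg
    rw [zero_sub, abs_neg, abs_of_nonneg n.cast_nonneg] at h1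
    have h2 := hyC n
    have h3 := dist_triangle4 (ρ.toFun 0) x (y n) (ρ.toFun n)
    have h4 := dist_triangle4 x (ρ.toFun 0) (ρ.toFun n) (y n)
    rw [dist_comm x (ρ.toFun 0)] at h4
    rw [dist_comm (y n)] at h3
    rw [abs_le]
    constructor <;> linarith
  have hy : Tendsto (fun n => dist x (y n)) atTop atTop := by
    refine tendsto_atTop_mono (f := fun n : ℕ => (n : ℝ) + -(dist (ρ.toFun 0) x + C)) ?_
      (tendsto_atTop_add_const_right _ _ tendsto_natCast_atTop_atTop)
    intro n
    have := (abs_le.1 (hlow n)).1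
    linarith
  obtain ⟨σ, hσ0, hσ⟩ := exists_limit_ray x y hy γ hγ
  have hC0 : 0 ≤ C := dist_nonneg.trans (hyC 0)
  have hmem : ∀ s, 0 ≤ s → ∀ᶠ n in atTop, s / dist x (y n) ∈ Set.Icc (0 : ℝ) 1 := by
    intro s hs
    filter_upwards [hy.eventually_ge_atTop s, hy.eventually_gt_atTop 0] with n h1 h2
    exact ⟨by positivity, (div_le_one h2).2 h1⟩
  refine ⟨σ, hσ0, GeodesicRay.cls_eq_of_bounded
    (C := dist (ρ.toFun 0) x + C + (dist (ρ.toFun 0) x + C)) fun s hs => ?_, fun s hs => ?_⟩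
  · refine le_of_tendsto ((hσ s hs).dist tendsto_const_nhds) (Nat.hyperfilter_le_atTop ?_)
    filter_upwards [hmem s hs, eventually_ge_atTop (Nat.ceil s), eventually_gt_atTop 0,
      hy.eventually_gt_atTop 0] with n h1 h2 h3 h4
    have hn : (0 : ℝ) < n := by exact_mod_cast h3
    have hsn : s / n ∈ Set.Icc (0 : ℝ) 1 :=
      ⟨by positivity, (div_le_one hn).2 (Nat.ceil_le.1 h2)⟩
    have h5 := (hγ n).dist_le (ρ.isGeodesicSeg hn.le) hsn
    simp only [div_mul_cancel₀ _ hn.ne'] at h5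
    have h6 := (hγ n).2.2 _ h1 _ hsn
    have h7 : |s / dist x (y n) - s / n| * dist x (y n) ≤ dist (ρ.toFun 0) x + C := by
      have e : s / dist x (y n) - s / n = s / n / dist x (y n) * (n - dist x (y n)) := by
        field_simp
      rw [e, abs_mul, abs_of_nonneg (by positivity), mul_right_comm,
        div_mul_cancel₀ _ h4.ne', abs_sub_comm]
      calc s / n * |dist x (y n) - n| ≤ 1 * |dist x (y n) - n| := by
            gcongr; exact hsn.2
        _ ≤ _ := by rw [one_mul]; exact hlow n
    have h8 : (1 - s / n) * dist x (ρ.toFun 0) + s / n * dist (y n) (ρ.toFun n) ≤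
        dist (ρ.toFun 0) x + C := by
      rw [dist_comm x, dist_comm (y n)]
      have a1 := mul_le_mul_of_nonneg_left (hyC n) hsn.1
      nlinarith [hsn.1, hsn.2, dist_nonneg (x := ρ.toFun 0) (y := x)]
    linarith [dist_triangle (γ n (s / dist x (y n))) (γ n (s / n)) (ρ.toFun s)]
  · refine hcl.mem_of_tendsto (hσ s hs) (Nat.hyperfilter_le_atTop ?_)
    filter_upwards [hmem s hs] with n h1
    exact hcv x hx _ (hyW n) _ (hγ n) _ h1

end Rays

section Center
variable [MetricSpace X]

theorem circumradiusIn_titsAngle_le {B : Set (Boundary X)}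
    (h : ∃ ξ ∈ B, ∀ η ∈ B, titsAngle ξ η ≤ Real.pi / 2) :
    circumradiusIn titsAngle B B ≤ Real.pi / 2 := by
  obtain ⟨ξ, hξ, h⟩ := h
  have hnn : ∀ ξ η : Boundary X, 0 ≤ titsAngle ξ η := by
    intro ξ η
    refine Real.sSup_nonneg ?_
    rintro a ⟨ρ, σ, -, -, -, rfl⟩
    refine Real.sInf_nonneg ?_
    rintro a ⟨s, -, t, -, rfl⟩
    exact Real.arccos_nonneg _
  refine (csInf_le ⟨0, ?_⟩ (mem_image_of_mem _ hξ)).trans (Real.sSup_le ?_ (by positivity))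
  · rintro _ ⟨ζ, -, rfl⟩
    refine Real.sSup_nonneg ?_
    rintro _ ⟨η, -, rfl⟩
    exact hnn _ _
  · rintro _ ⟨η, hη, rfl⟩
    exact h η hη

theorem boundarySet_nonempty_of_circumradius {B : Set (Boundary X)}
    (hrad : Real.pi / 2 < circumradiusIn titsAngle B B) : B.Nonempty := by
  by_contra hne
  rw [Set.not_nonempty_iff_eq_empty] at hne
  subst hne
  simp only [circumradiusIn, image_empty, Real.sInf_empty] at hrad
  linarith [Real.pi_pos]

variable [CAT0Space X]

theorem titsAngle_le_pi_div_two {ρ σ : GeodesicRay X} {K : ℝ}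
    (h : ∀ s, 0 ≤ s → ∃ T, ∀ t, T ≤ t → dist (ρ.toFun s) (σ.toFun t) ≤ t + K) :
    titsAngle ρ.cls σ.cls ≤ Real.pi / 2 := by
  refine Real.sSup_le ?_ (by positivity)
  rintro a ⟨ρ', σ', h0, hρ, hσ, rfl⟩
  by_contra! hlt
  obtain ⟨C₁, hC₁⟩ := Quotient.exact hρ
  obtain ⟨C₂, hC₂⟩ := Quotient.exact hσ
  set A := alexAngleRays ρ'.toFun σ'.toFun with hA
  set θ := min ((A + Real.pi / 2) / 2) Real.pi with hθ
  have hπ := Real.pi_pos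
  have hθ1 : Real.pi / 2 < θ := lt_min (by linarith) (by linarith)
  have hθ2 : θ ≤ Real.pi := min_le_right _ _
  have hθ3 : θ < A := (min_le_left _ _).trans_lt (by linarith)
  have hcos : Real.cos θ < 0 := Real.cos_neg_of_pi_div_two_lt_of_lt hθ1 (by linarith)
  set M := max (C₁ + C₂ + K) 1 with hM
  have hM1 : 1 ≤ M := le_max_right _ _
  set S := max M (M / -Real.cos θ) with hS
  have hSM : M ≤ S := le_max_left _ _
  have hS1 : 1 ≤ S := hM1.trans hSM
  have hMS1 : M / S ≤ 1 := (div_le_one (by linarith)).2 hSM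
  have hMS0 : 0 ≤ M / S := by positivity
  have hMS2 : M / S ≤ -Real.cos θ := by
    rw [div_le_comm₀ (by linarith) (by linarith)]
    exact le_max_right _ _
  obtain ⟨T, hT⟩ := h S (by linarith)
  set t := max T 1 with ht
  have ht1 : 1 ≤ t := le_max_right _ _
  have hfar : dist (ρ'.toFun S) (σ'.toFun t) ≤ t + M := by
    have h1 := hC₁ S (by linarith)
    have h2 := hC₂ t (by linarith)
    have h3 := hT t (le_max_left _ _)
    have h4 := dist_triangle4 (ρ'.toFun S) (ρ.toFun S) (σ.toFun t) (σ'.toFun t)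
    rw [dist_comm (σ.toFun t)] at h4
    have h5 : C₁ + C₂ + K ≤ M := le_max_left _ _
    linarith
  have ht0 : dist (ρ'.toFun 0) (σ'.toFun t) = t := by
    rw [h0, σ'.isom 0 le_rfl t (by linarith), zero_sub, abs_neg, abs_of_nonneg (by linarith)]
  have hs0 : dist (ρ'.toFun 0) (ρ'.toFun 1) = 1 := by
    rw [ρ'.isom 0 le_rfl 1 (by norm_num)]; norm_num
  have hnear : dist (ρ'.toFun 1) (σ'.toFun t) ≤ t + M / S := by
    have h1 := (ρ'.isGeodesicSeg (show 0 ≤ S by linarith)).dist_le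
      (isGeodesicSeg_const (σ'.toFun t)) (t := 1 / S)
      ⟨by positivity, (div_le_one (by linarith)).2 hS1⟩
    simp only [div_mul_cancel₀ _ (show S ≠ 0 by linarith)] at h1
    rw [ht0] at h1
    have h2 : 1 / S * dist (ρ'.toFun S) (σ'.toFun t) ≤ 1 / S * (t + M) := by gcongr
    have h3 : (1 - 1 / S) * t + 1 / S * (t + M) = t + M / S := by ring
    linarith
  have hle : A ≤ cmpAngle (ρ'.toFun 0) (ρ'.toFun 1) (σ'.toFun t) := by
    refine csInf_le ⟨0, ?_⟩ ⟨1, by norm_num, t, by linarith, rfl⟩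
    rintro a ⟨s, -, t, -, rfl⟩
    exact Real.arccos_nonneg _
  have hge : cmpAngle (ρ'.toFun 0) (ρ'.toFun 1) (σ'.toFun t) ≤ θ := by
    rw [cmpAngle, ← Real.arccos_cos (show 0 ≤ θ by linarith) hθ2]
    refine Real.arccos_le_arccos ?_
    rw [ht0, hs0, le_div_iff₀ (by linarith)]
    have h1 : dist (ρ'.toFun 1) (σ'.toFun t) ^ 2 ≤ (t + M / S) ^ 2 :=
      pow_le_pow_left₀ dist_nonneg hnear 2
    nlinarith
  linarith

variable [ProperSpace X]

/-- If closed convex sets with a common boundary recede from a point, then their boundary has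
circumradius at most `π / 2`. -/
theorem exists_titsAngle_le_pi_div_two {B : Set (Boundary X)} {W : ℕ → Set X}
    (hcl : ∀ n, IsClosed (W n)) (hcv : ∀ n, GeoConvex (W n)) (hne : ∀ n, (W n).Nonempty)
    (hB : ∀ n, boundarySet (W n) = B) (hsub : ∀ᶠ n in atTop, W n ⊆ W 0) {p : X}
    (hp : Tendsto (fun n => Metric.infDist p (W n)) atTop atTop) :
    ∃ ξ ∈ B, ∀ η ∈ B, titsAngle ξ η ≤ Real.pi / 2 := by
  set y : ℕ → X := fun n => nearestPt (W n) p with hydef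
  have hyW : ∀ n, y n ∈ W n := fun n => nearestPt_mem (hcl n) (hne n) p
  have hy : Tendsto (fun n => dist p (y n)) atTop atTop := by
    simpa only [hydef, dist_nearestPt (hcl _) (hne _)] using hp
  choose γ hγ using fun n => CAT0Space.exists_geodesic p (y n)
  obtain ⟨ρ, hρ0, hρ⟩ := exists_limit_ray p y hy γ hγ
  have happrox : ∀ s, 0 ≤ s → ∃ n, W n ⊆ W 0 ∧ s / dist p (y n) ∈ Set.Icc (0 : ℝ) 1 ∧
      dist p (γ n (s / dist p (y n))) = s ∧
      dist (ρ.toFun s) (γ n (s / dist p (y n))) ≤ 1 := by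
    intro s hs
    have h1 : ∀ᶠ n in (hyperfilter ℕ : Filter ℕ), dist (γ n (s / dist p (y n))) (ρ.toFun s) < 1 :=
      (hρ s hs).eventually (Metric.ball_mem_nhds _ one_pos)
    have h2 : ∀ᶠ n in (hyperfilter ℕ : Filter ℕ), W n ⊆ W 0 ∧ s ≤ dist p (y n) ∧
        0 < dist p (y n) :=
      Nat.hyperfilter_le_atTop
        (hsub.and ((hy.eventually_ge_atTop s).and (hy.eventually_gt_atTop 0)))
    obtain ⟨n, h3, h4, h5, h6⟩ := (h1.and h2).exists
    have h7 : s / dist p (y n) ∈ Set.Icc (0 : ℝ) 1 := ⟨by positivity, (div_le_one h6).2 h5⟩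
    refine ⟨n, h4, h7, ?_, ?_⟩
    · rw [(hγ n).dist_left h7, div_mul_cancel₀ _ h6.ne']
    · rw [dist_comm]; exact h3.le
  refine ⟨ρ.cls, ?_, fun η hη => ?_⟩
  · rw [← hB 0]
    obtain ⟨w, hw⟩ := hne 0
    refine ⟨ρ, rfl, 1 + dist p w, fun s hs => ?_⟩
    obtain ⟨n, h1, h2, -, h3⟩ := happrox s hs
    obtain ⟨δ, hδ⟩ := CAT0Space.exists_geodesic w (y n)
    refine ⟨_, hcv 0 w hw _ (h1 (hyW n)) δ hδ _ h2, (dist_triangle _ _ _).trans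
      (add_le_add h3 (((hγ n).dist_le hδ h2).trans ?_))⟩
    rw [dist_self]
    nlinarith [h2.1, dist_nonneg (x := p) (y := w)]
  · obtain ⟨σ, hσ0, rfl, -⟩ := exists_ray_mem isClosed_univ (fun _ _ _ _ _ _ _ _ => mem_univ _)
      (mem_univ p) (boundarySet_mono (subset_univ _) ((hB 0).symm ▸ hη))
    refine titsAngle_le_pi_div_two (K := 2) fun s hs => ?_
    obtain ⟨n, -, h2, h3, h4⟩ := happrox s hs
    obtain ⟨τ, hτ0, hτ, hτW⟩ := exists_ray_mem (hcl n) (hcv n) (hyW n) ((hB n).symm ▸ hη)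
    refine ⟨s * dist p (y n), fun t ht => ?_⟩
    have ht0 : 0 ≤ t := (mul_nonneg hs dist_nonneg).trans ht
    set x := γ n (s / dist p (y n))
    have h5 : dist (y n) (τ.toFun t) ≤ dist p (τ.toFun t) := by
      have := nearestPt_dist_sq_le (hcl n) (hcv n) p (hτW t ht0)
      refine abs_le_of_sq_le_sq' (b := dist p (τ.toFun t)) ?_ dist_nonneg |>.2
      nlinarith [sq_nonneg (dist p (nearestPt (W n) p))]
    have h6 : dist x (τ.toFun t) ≤ dist p (τ.toFun t) := by
      have := (hγ n).dist_le (isGeodesicSeg_const (τ.toFun t)) h2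
      nlinarith [h2.1]
    have h7 := CAT0Space.dist_sq_add_dist_sq_le x p (σ.toFun t) (τ.toFun t)
    have h8 := GeodesicRay.dist_le_of_cls_eq hτ ht0
    rw [hτ0, hσ0, dist_comm, dist_comm (y n)] at h8
    have h9 : dist p (σ.toFun t) = t := by
      rw [← hσ0, σ.isom 0 le_rfl t ht0, zero_sub, abs_neg, abs_of_nonneg ht0]
    rw [dist_comm x p, h3, h9] at h7
    have h10 : dist x (τ.toFun t) ^ 2 ≤ dist p (τ.toFun t) ^ 2 :=
      pow_le_pow_left₀ dist_nonneg h6 2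
    have h11 : dist x (σ.toFun t) ≤ t + 1 := by
      refine abs_le_of_sq_le_sq' ?_ (by linarith) |>.2
      nlinarith [mul_le_mul_of_nonneg_left h8 hs]
    linarith [dist_triangle (ρ.toFun s) x (σ.toFun t)]

theorem exists_minimalFullSub {Y : Set X} (hYcl : IsClosed Y) (hYcv : GeoConvex Y)
    (hrad : Real.pi / 2 < circumradiusIn titsAngle (boundarySet Y) (boundarySet Y)) :
    ∃ Z : Set X, MinimalFullSub X Y Z := by
  have hBne := boundarySet_nonempty_of_circumradius hrad
  set F : Set (Set X) := {W | IsClosed W ∧ GeoConvex W ∧ boundarySet W = boundarySet Y} with hF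
  have hFne : ∀ W ∈ F, W.Nonempty := fun W hW =>
    nonempty_of_boundarySet_nonempty (by rw [hW.2.2]; exact hBne)
  have hchain : ∀ c ⊆ F, IsChain (· ⊆ ·) c → ∃ lb ∈ F, ∀ s ∈ c, lb ⊆ s := by
    intro c hc hchain
    rcases c.eq_empty_or_nonempty with rfl | hcne
    · exact ⟨Y, ⟨hYcl, hYcv, rfl⟩, by simp⟩
    have hInter : (⋂₀ c).Nonempty := by
      by_contra hemp
      obtain ⟨p, -⟩ := hFne Y ⟨hYcl, hYcv, rfl⟩
      have hex : ∀ n : ℕ, ∃ W ∈ c, W ∩ Metric.closedBall p n = ∅ := by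
        intro n
        by_contra! hall
        refine hemp ?_
        have hne : (⋂₀ ((fun W => W ∩ Metric.closedBall p n) '' c)).Nonempty := by
          refine IsCompact.nonempty_sInter_of_directed_nonempty_isCompact_isClosed
            (hS := (hcne.image _).to_subtype) ?_ ?_ ?_ ?_
          · rintro _ ⟨U, hU, rfl⟩ _ ⟨V, hV, rfl⟩
            rcases hchain.total hU hV with h | h
            · exact ⟨_, ⟨U, hU, rfl⟩, subset_rfl, inter_subset_inter_left _ h⟩
            · exact ⟨_, ⟨V, hV, rfl⟩, inter_subset_inter_left _ h, subset_rfl⟩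
          · rintro _ ⟨U, hU, rfl⟩
            exact hall U hU
          · rintro _ ⟨U, hU, rfl⟩
            exact (isCompact_closedBall p n).inter_left (hc hU).1
          · rintro _ ⟨U, hU, rfl⟩
            exact (hc hU).1.inter Metric.isClosed_closedBall
        obtain ⟨z, hz⟩ := hne
        exact ⟨z, fun W hW => (hz _ ⟨W, hW, rfl⟩).1⟩
      choose W hWc hW using hex
      have hfar : ∀ n, ∀ w ∈ W n, (n : ℝ) < dist p w := by
        intro n w hw
        by_contra! hle
        have : w ∈ W n ∩ Metric.closedBall p n := ⟨hw, by rwa [Metric.mem_closedBall, dist_comm]⟩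
        rw [hW n] at this
        exact this
      have hp : Tendsto (fun n => Metric.infDist p (W n)) atTop atTop :=
        tendsto_atTop_mono (fun n => (Metric.le_infDist (hFne _ (hc (hWc n)))).2
          fun {w} hw => (hfar n w hw).le) tendsto_natCast_atTop_atTop
      have hsub : ∀ᶠ n in atTop, W n ⊆ W 0 := by
        obtain ⟨w, hw⟩ := hFne _ (hc (hWc 0))
        filter_upwards [eventually_ge_atTop (Nat.ceil (dist p w))] with n hn
        rcases hchain.total (hWc n) (hWc 0) with h | h
        · exact h
        · exact absurd (hfar n w (h hw)) (not_lt.2 (Nat.ceil_le.1 hn))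
      exact absurd (circumradiusIn_titsAngle_le (exists_titsAngle_le_pi_div_two
        (fun n => (hc (hWc n)).1) (fun n => (hc (hWc n)).2.1) (fun n => hFne _ (hc (hWc n)))
        (fun n => (hc (hWc n)).2.2) hsub hp)) (not_le.2 hrad)
    obtain ⟨x, hx⟩ := hInter
    obtain ⟨U, hU⟩ := hcne
    refine ⟨⋂₀ c, ⟨isClosed_sInter fun W hW => (hc hW).1, ?_, ?_⟩, fun W hW =>
      sInter_subset_of_mem hW⟩
    · exact fun u hu v hv γ hγ t ht W hW => (hc hW).2.1 u (hu W hW) v (hv W hW) γ hγ t ht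
    · refine subset_antisymm ?_ fun ξ hξ => ?_
      · rw [← (hc hU).2.2]
        exact boundarySet_mono (sInter_subset_of_mem hU)
      · have hray : ∀ W ∈ c, ∃ ρ : GeodesicRay X, ρ.toFun 0 = x ∧ ρ.cls = ξ ∧
            ∀ s, 0 ≤ s → ρ.toFun s ∈ W := fun W hW =>
          exists_ray_mem (hc hW).1 (hc hW).2.1 (hx W hW) ((hc hW).2.2.symm ▸ hξ)
        obtain ⟨ρ, hρ0, hρ, -⟩ := hray U hU
        refine ⟨ρ, hρ, 0, fun t ht => ⟨ρ.toFun t, fun W hW => ?_, by simp⟩⟩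
        obtain ⟨σ, hσ0, hσ, hσW⟩ := hray W hW
        have := GeodesicRay.dist_le_of_cls_eq (hρ.trans hσ.symm) ht
        rw [hρ0, hσ0, dist_self] at this
        rw [dist_le_zero.1 this]
        exact hσW t ht
  obtain ⟨Z, hZ⟩ := zorn_superset F hchain
  exact ⟨Z, hZ.prop.1, hZ.prop.2.1, hZ.prop.2.2, fun W hcl hcv hW hWZ =>
    hZ.eq_of_subset ⟨hcl, hcv, hW⟩ hWZ⟩

end Center

section Minimal
variable [MetricSpace X] {Y W W₁ W₂ W₃ : Set X}

theorem MinimalFullSub.nonempty (h : MinimalFullSub X Y W) (hY : (boundarySet Y).Nonempty) :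
    W.Nonempty :=
  nonempty_of_boundarySet_nonempty (h.2.2.1 ▸ hY)

variable [CAT0Space X] [ProperSpace X]

theorem MinimalFullSub.infDist_le (h₁ : MinimalFullSub X Y W₁) (h₂ : MinimalFullSub X Y W₂)
    (hY : (boundarySet Y).Nonempty) {z w : X} (hz : z ∈ W₁) (hw : w ∈ W₁) :
    Metric.infDist w W₂ ≤ Metric.infDist z W₂ := by
  have hne := h₂.nonempty hY
  have hS : {u ∈ W₁ | Metric.infDist u W₂ ≤ Metric.infDist z W₂} = W₁ := by
    refine h₁.2.2.2 _ ?_ ?_ ?_ (sep_subset _ _)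
    · exact h₁.1.inter (isClosed_le (Metric.continuous_infDist_pt W₂) continuous_const)
    · rintro u ⟨hu, hu'⟩ v ⟨hv, hv'⟩ γ hγ t ht
      refine ⟨h₁.2.1 u hu v hv γ hγ t ht,
        (infDist_seg_le h₂.1 h₂.2.1 hne hγ ht).trans ?_⟩
      nlinarith [mul_le_mul_of_nonneg_left hu' (sub_nonneg.2 ht.2),
        mul_le_mul_of_nonneg_left hv' ht.1]
    · refine subset_antisymm ?_ fun ξ hξ => ?_
      · rw [← h₁.2.2.1]
        exact boundarySet_mono (sep_subset _ _)
      · obtain ⟨ρ, hρ0, hρ, hρW⟩ := exists_ray_mem h₁.1 h₁.2.1 hz (h₁.2.2.1.symm ▸ hξ)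
        obtain ⟨σ, hσ0, hσ, hσW⟩ := exists_ray_mem h₂.1 h₂.2.1 (nearestPt_mem h₂.1 hne z)
          (h₂.2.2.1.symm ▸ hξ)
        refine ⟨ρ, hρ, 0, fun t ht => ⟨ρ.toFun t, ⟨hρW t ht, ?_⟩, by simp⟩⟩
        have := GeodesicRay.dist_le_of_cls_eq (hρ.trans hσ.symm) ht
        rw [hρ0, hσ0, dist_nearestPt h₂.1 hne] at this
        exact (Metric.infDist_le_dist_of_mem (hσW t ht)).trans this
  rw [← hS] at hw
  exact hw.2

theorem MinimalFullSub.infDist_eq (h₁ : MinimalFullSub X Y W₁) (h₂ : MinimalFullSub X Y W₂)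
    (hY : (boundarySet Y).Nonempty) {z w : X} (hz : z ∈ W₁) (hw : w ∈ W₁) :
    Metric.infDist z W₂ = Metric.infDist w W₂ :=
  le_antisymm (h₁.infDist_le h₂ hY hw hz) (h₁.infDist_le h₂ hY hz hw)

theorem MinimalFullSub.infDist_symm (h₁ : MinimalFullSub X Y W₁) (h₂ : MinimalFullSub X Y W₂)
    (hY : (boundarySet Y).Nonempty) {z w : X} (hz : z ∈ W₁) (hw : w ∈ W₂) :
    Metric.infDist z W₂ = Metric.infDist w W₁ := by
  have key : ∀ {U V : Set X}, MinimalFullSub X Y U → MinimalFullSub X Y V → ∀ {z w : X}, z ∈ U →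
      w ∈ V → Metric.infDist w U ≤ Metric.infDist z V := by
    intro U V hU hV z w hz hw
    rw [hV.infDist_eq hU hY hw (nearestPt_mem hV.1 ⟨w, hw⟩ z), ← dist_nearestPt hV.1 ⟨w, hw⟩,
      dist_comm]
    exact Metric.infDist_le_dist_of_mem hz
  exact le_antisymm (key h₂ h₁ hw hz) (key h₁ h₂ hz hw)

theorem MinimalFullSub.nearestPt_nearestPt (h₁ : MinimalFullSub X Y W₁)
    (h₂ : MinimalFullSub X Y W₂) (hY : (boundarySet Y).Nonempty) {z : X} (hz : z ∈ W₁) :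
    nearestPt W₁ (nearestPt W₂ z) = z := by
  have hne := h₂.nonempty hY
  refine eq_nearestPt h₁.1 h₁.2.1 hz ?_
  rw [dist_comm, dist_nearestPt h₂.1 hne,
    h₁.infDist_symm h₂ hY hz (nearestPt_mem h₂.1 hne z)]

theorem MinimalFullSub.dist_nearestPt_nearestPt (h₁ : MinimalFullSub X Y W₁)
    (h₂ : MinimalFullSub X Y W₂) (hY : (boundarySet Y).Nonempty) {z w : X} (hz : z ∈ W₁)
    (hw : w ∈ W₁) : dist (nearestPt W₂ z) (nearestPt W₂ w) = dist z w := by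
  refine le_antisymm (dist_nearestPt_nearestPt_le h₂.1 h₂.2.1 (h₂.nonempty hY) z w) ?_
  have := dist_nearestPt_nearestPt_le h₁.1 h₁.2.1 ⟨z, hz⟩ (nearestPt W₂ z) (nearestPt W₂ w)
  rwa [h₁.nearestPt_nearestPt h₂ hY hz, h₁.nearestPt_nearestPt h₂ hY hw] at this

/-- Two minimal sets bound a flat product region: the Pythagorean theorem holds in it. -/
theorem MinimalFullSub.dist_sq_eq (h₁ : MinimalFullSub X Y W₁) (h₂ : MinimalFullSub X Y W₂)
    (hY : (boundarySet Y).Nonempty) {x y : X} (hx : x ∈ W₁) (hy : y ∈ W₂) :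
    dist x y ^ 2 = Metric.infDist x W₂ ^ 2 + dist (nearestPt W₂ x) y ^ 2 := by
  have hx' := dist_nearestPt h₂.1 ⟨y, hy⟩ x
  have hw := nearestPt_mem h₁.1 ⟨x, hx⟩ y
  have hyw : nearestPt W₂ (nearestPt W₁ y) = y := h₂.nearestPt_nearestPt h₁ hY hy
  have h3 := nearestPt_dist_sq_le h₂.1 h₂.2.1 x hy
  have h4 := nearestPt_dist_sq_le h₂.1 h₂.2.1 (nearestPt W₁ y) (nearestPt_mem h₂.1 ⟨y, hy⟩ x)
  have h5 := CAT0Space.dist_sq_add_dist_sq_le x (nearestPt W₁ y) y (nearestPt W₂ x)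
  have h6 := h₁.dist_nearestPt_nearestPt h₂ hY hx hw
  rw [hyw] at h4 h6
  rw [← h6, dist_comm y (nearestPt W₂ x), hx'] at h5
  rw [dist_comm y (nearestPt W₂ x)] at h4
  rw [hx'] at h3
  nlinarith

theorem MinimalFullSub.exists_dist_sq_nearestPt_le (h₁ : MinimalFullSub X Y W₁)
    (h₂ : MinimalFullSub X Y W₂) (hY : (boundarySet Y).Nonempty) (x : X) :
    ∃ K, ∀ w ∈ W₁, dist x (nearestPt W₂ w) ^ 2 ≤ dist x w ^ 2 + K := by
  obtain ⟨y, hy⟩ := h₁.nonempty hY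
  have hne := h₂.nonempty hY
  refine ⟨Metric.infDist y W₂ ^ 2 + 2 * dist x y * Metric.infDist y W₂, fun w hw => ?_⟩
  have h3 := CAT0Space.dist_sq_add_dist_sq_le x y (nearestPt W₂ w) w
  rw [h₁.dist_sq_eq h₂ hY hy (nearestPt_mem h₂.1 hne w),
    h₁.dist_nearestPt_nearestPt h₂ hY hy hw, dist_comm (nearestPt W₂ w) w,
    dist_nearestPt h₂.1 hne, h₁.infDist_eq h₂ hY hw hy] at h3
  linarith

/-- A self-isometry of a minimal set at bounded distance from the identity has constant
displacement. -/
theorem MinimalFullSub.displacement_le (h : MinimalFullSub X Y W) {g : X → X} {K : ℝ}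
    (hg : ∀ u ∈ W, ∀ v ∈ W, dist (g u) (g v) = dist u v)
    (hK : ∀ u ∈ W, dist u (g u) ≤ K) {z w : X} (hz : z ∈ W) (hw : w ∈ W) :
    dist w (g w) ≤ dist z (g z) := by
  have hcont : ContinuousOn g W := by
    refine LipschitzOnWith.continuousOn (K := 1) (LipschitzOnWith.of_dist_le_mul fun u hu v hv => ?_)
    simp [hg u hu v hv]
  have hS : {u ∈ W | dist u (g u) ≤ dist z (g z)} = W := by
    refine h.2.2.2 _ ?_ ?_ ?_ (sep_subset _ _)
    · exact (continuous_dist.comp_continuousOn (continuousOn_id.prodMk hcont)).preimage_isClosed_of_isClosed h.1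
        isClosed_Iic
    · rintro u ⟨hu, hu'⟩ v ⟨hv, hv'⟩ γ hγ t ht
      have hγW := h.2.1 u hu v hv γ hγ
      refine ⟨hγW t ht, (hγ.dist_le (hγ.map_of_dist_eq hg hγW) ht).trans ?_⟩
      nlinarith [mul_le_mul_of_nonneg_left hu' (sub_nonneg.2 ht.2),
        mul_le_mul_of_nonneg_left hv' ht.1]
    · refine subset_antisymm ?_ fun ξ hξ => ?_
      · rw [← h.2.2.1]
        exact boundarySet_mono (sep_subset _ _)
      · obtain ⟨ρ, hρ0, hρ, hρW⟩ := exists_ray_mem h.1 h.2.1 hz (h.2.2.1.symm ▸ hξ)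
        refine ⟨ρ, hρ, 0, fun t ht => ⟨ρ.toFun t, ⟨hρW t ht, ?_⟩, by simp⟩⟩
        have := ρ.dist_le_of_bounded ⟨fun t => g (ρ.toFun t), fun s hs t ht => by
          rw [hg _ (hρW s hs) _ (hρW t ht), ρ.isom s hs t ht]⟩ (fun t ht => hK _ (hρW t ht)) ht
        dsimp only at this
        rwa [hρ0] at this
  rw [← hS] at hw
  exact hw.2

theorem MinimalFullSub.two_pow_mul_displacement_le (h : MinimalFullSub X Y W) (k : ℕ) :
    ∀ {g : X → X} {K : ℝ}, MapsTo g W W → (∀ u ∈ W, ∀ v ∈ W, dist (g u) (g v) = dist u v) →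
      (∀ u ∈ W, dist u (g u) ≤ K) → ∀ {z : X}, z ∈ W →
        2 ^ k * dist z (g z) ≤ dist z (g^[2 ^ k] z) := by
  induction k with
  | zero => intro g K _ _ _ z _; simp
  | succ k ih =>
    intro g K hmaps hg hK z hz
    have h2 := ih (g := g^[2]) (K := K + K) (hmaps.iterate 2)
      (fun u hu v hv => by
        simp only [Function.iterate_succ, Function.iterate_zero, Function.comp_apply, id]
        rw [hg _ (hmaps hu) _ (hmaps hv), hg u hu v hv])
      (fun u hu => (dist_triangle u (g u) (g (g u))).trans
        (add_le_add (hK u hu) (hK _ (hmaps hu)))) hz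
    have e0 : g^[2 ^ (k + 1)] = (g^[2])^[2 ^ k] := by rw [pow_succ', Function.iterate_mul]
    rw [e0, pow_succ, mul_assoc]
    refine le_trans ?_ h2
    gcongr
    obtain ⟨γ, hγ⟩ := CAT0Space.exists_geodesic z (g z)
    have hγW := h.2.1 z hz _ (hmaps hz) γ hγ
    have hhalf : (1 / 2 : ℝ) ∈ Set.Icc (0 : ℝ) 1 := ⟨by norm_num, by norm_num⟩
    have h3 := hγ.symm.dist_le (hγ.map_of_dist_eq hg hγW) hhalf
    have h4 := h.displacement_le hg hK (hγW _ hhalf) hz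
    have e : (1 - 1 / 2 : ℝ) = 1 / 2 := by norm_num
    rw [dist_self, e] at h3
    have e2 : g^[2] z = g (g z) := rfl
    rw [e2]
    linarith

/-- The projections between minimal sets have no holonomy. -/
theorem MinimalFullSub.nearestPt_nearestPt_nearestPt (h₁ : MinimalFullSub X Y W₁)
    (h₂ : MinimalFullSub X Y W₂) (h₃ : MinimalFullSub X Y W₃) (hY : (boundarySet Y).Nonempty)
    {z : X} (hz : z ∈ W₁) : nearestPt W₁ (nearestPt W₃ (nearestPt W₂ z)) = z := by
  have m₁ := nearestPt_mem h₁.1 (h₁.nonempty hY)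
  have m₂ := nearestPt_mem h₂.1 (h₂.nonempty hY)
  have m₃ := nearestPt_mem h₃.1 (h₃.nonempty hY)
  set g : X → X := fun z => nearestPt W₁ (nearestPt W₃ (nearestPt W₂ z)) with hgdef
  have hmaps : MapsTo g W₁ W₁ := fun _ _ => m₁ _
  have hg : ∀ u ∈ W₁, ∀ v ∈ W₁, dist (g u) (g v) = dist u v := by
    intro u hu v hv
    rw [hgdef, h₃.dist_nearestPt_nearestPt h₁ hY (m₃ _) (m₃ _),
      h₂.dist_nearestPt_nearestPt h₃ hY (m₂ _) (m₂ _), h₁.dist_nearestPt_nearestPt h₂ hY hu hv]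
  have hK : ∀ u ∈ W₁, dist u (g u) ≤ Metric.infDist z W₂ +
      Metric.infDist (nearestPt W₂ z) W₃ + Metric.infDist (nearestPt W₃ z) W₁ := by
    intro u hu
    refine (dist_triangle4 _ (nearestPt W₂ u) (nearestPt W₃ (nearestPt W₂ u)) _).trans ?_
    rw [dist_nearestPt h₂.1 (h₂.nonempty hY), dist_nearestPt h₃.1 (h₃.nonempty hY),
      dist_nearestPt h₁.1 (h₁.nonempty hY), h₁.infDist_eq h₂ hY hu hz,
      h₂.infDist_eq h₃ hY (m₂ u) (m₂ z), h₃.infDist_eq h₁ hY (m₃ (nearestPt W₂ u)) (m₃ z)]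
  by_contra hne
  have hD : 0 < dist z (g z) := dist_pos.2 (Ne.symm hne)
  obtain ⟨K₁, hK₁⟩ := h₁.exists_dist_sq_nearestPt_le h₂ hY (g z)
  obtain ⟨K₂, hK₂⟩ := h₂.exists_dist_sq_nearestPt_le h₃ hY (g z)
  obtain ⟨K₃, hK₃⟩ := h₃.exists_dist_sq_nearestPt_le h₁ hY (g z)
  have hupper : ∀ m, g^[m] z ∈ W₁ ∧ dist z (g^[m] z) ≤ m * dist z (g z) := by
    intro m
    induction m with
    | zero => simpa using hz
    | succ m ih =>
      refine ⟨hmaps.iterate (m + 1) hz, ?_⟩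
      have h4 := hg _ hz _ ih.1
      rw [← Function.iterate_succ_apply' g m z] at h4
      have h5 := dist_triangle z (g z) (g^[m + 1] z)
      push_cast
      linarith [ih.2]
  have hbound : ∀ k : ℕ, (k : ℝ) * dist z (g z) ^ 2 ≤ K₁ + K₂ + K₃ := by
    intro k
    obtain ⟨m, hm⟩ := Nat.exists_eq_succ_of_ne_zero (pow_ne_zero k (two_ne_zero (α := ℕ)))
    have hlow := h₁.two_pow_mul_displacement_le k hmaps hg hK hz
    have hcast : (2 : ℝ) ^ k = m + 1 := by exact_mod_cast hm
    rw [hm, hcast] at hlow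
    obtain ⟨hmem, hup⟩ := hupper m
    have hn := (hupper (m + 1)).1
    have h4 : dist (g z) (g (g^[m + 1] z)) ^ 2 ≤
        dist (g z) (g^[m + 1] z) ^ 2 + (K₁ + K₂ + K₃) := by
      have a1 := hK₁ _ hn
      have a2 := hK₂ _ (m₂ (g^[m + 1] z))
      have a3 := hK₃ _ (m₃ (nearestPt W₂ (g^[m + 1] z)))
      change dist (g z) (g (g^[m + 1] z)) ^ 2 ≤ _ at a3
      linarith
    rw [hg _ hz _ hn, Function.iterate_succ_apply' g m z, hg _ hz _ hmem,
      ← Function.iterate_succ_apply' g m z] at h4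
    have h5 : ((m + 1) * dist z (g z)) ^ 2 ≤ dist z (g^[m + 1] z) ^ 2 :=
      pow_le_pow_left₀ (by positivity) hlow 2
    have h6 : dist z (g^[m] z) ^ 2 ≤ (m * dist z (g z)) ^ 2 :=
      pow_le_pow_left₀ dist_nonneg hup 2
    have h7 : (k : ℝ) ≤ m := by
      have : k < 2 ^ k := Nat.lt_two_pow_self
      exact_mod_cast (by omega : k ≤ m)
    have h8 := mul_le_mul_of_nonneg_right h7 (sq_nonneg (dist z (g z)))
    nlinarith [mul_nonneg (m.cast_nonneg (α := ℝ)) (sq_nonneg (dist z (g z))),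
      sq_nonneg (dist z (g z))]
  obtain ⟨k, hk⟩ := exists_nat_gt ((K₁ + K₂ + K₃) / dist z (g z) ^ 2)
  rw [div_lt_iff₀ (by positivity)] at hk
  linarith [hbound k]

theorem MinimalFullSub.nearestPt_nearestPt_eq (h₁ : MinimalFullSub X Y W₁)
    (h₂ : MinimalFullSub X Y W₂) (h₃ : MinimalFullSub X Y W₃) (hY : (boundarySet Y).Nonempty)
    {z : X} (hz : z ∈ W₁) : nearestPt W₃ (nearestPt W₂ z) = nearestPt W₃ z := by
  have h4 := h₁.nearestPt_nearestPt_nearestPt h₂ h₃ hY hz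
  have h5 := h₃.nearestPt_nearestPt h₁ hY
    (nearestPt_mem h₃.1 (h₃.nonempty hY) (nearestPt W₂ z))
  rw [← h5, h4]

theorem MinimalFullSub.eq_of_mem (h₁ : MinimalFullSub X Y W₁) (h₂ : MinimalFullSub X Y W₂)
    (hY : (boundarySet Y).Nonempty) {z : X} (hz₁ : z ∈ W₁) (hz₂ : z ∈ W₂) : W₁ = W₂ := by
  refine h₂.2.2.2 W₁ h₁.1 h₁.2.1 h₁.2.2.1 fun w hw => ?_
  rw [h₂.1.mem_iff_infDist_zero ⟨z, hz₂⟩, h₁.infDist_eq h₂ hY hw hz₁]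
  exact Metric.infDist_zero_of_mem hz₂

theorem MinimalFullSub.image (h : MinimalFullSub X Y W) {φ : X → X} {K : ℝ}
    (hφ : ∀ u ∈ W, ∀ v ∈ W, dist (φ u) (φ v) = dist u v) (hK : ∀ u ∈ W, dist u (φ u) ≤ K) :
    MinimalFullSub X Y (φ '' W) := by
  have hcont : ContinuousOn φ W := by
    refine LipschitzOnWith.continuousOn (K := 1) (LipschitzOnWith.of_dist_le_mul fun u hu v hv => ?_)
    simp [hφ u hu v hv]
  refine ⟨?_, ?_, ?_, fun V hVcl hVcv hV hVsub => ?_⟩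
  · have : CompleteSpace W := h.1.completeSpace_coe
    have hiso : Isometry (W.domRestrict φ) := Isometry.of_dist_eq fun u v => hφ u u.2 v v.2
    simpa only [range_domRestrict] using hiso.isClosedEmbedding.isClosed_range
  · rintro _ ⟨z, hz, rfl⟩ _ ⟨w, hw, rfl⟩ γ hγ t ht
    obtain ⟨δ, hδ⟩ := CAT0Space.exists_geodesic z w
    have hδW := h.2.1 z hz w hw δ hδ
    exact ⟨δ t, hδW t ht, hγ.eq_of_isGeodesicSeg (hδ.map_of_dist_eq hφ hδW) ht⟩
  · rw [← h.2.2.1]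
    refine subset_antisymm (boundarySet_subset_of_dist_le (K := K) ?_)
      (boundarySet_subset_of_dist_le (K := K) fun u hu => ⟨φ u, mem_image_of_mem φ hu, hK u hu⟩)
    rintro _ ⟨u, hu, rfl⟩
    exact ⟨u, hu, by rw [dist_comm]; exact hK u hu⟩
  · have hpre : W ∩ φ ⁻¹' V = W := by
      refine h.2.2.2 _ (hcont.preimage_isClosed_of_isClosed h.1 hVcl) ?_ ?_ inter_subset_left
      · rintro u ⟨hu, hu'⟩ v ⟨hv, hv'⟩ γ hγ t ht
        have hγW := h.2.1 u hu v hv γ hγ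
        exact ⟨hγW t ht, hVcv _ hu' _ hv' _ (hγ.map_of_dist_eq hφ hγW) t ht⟩
      · rw [← hV]
        refine subset_antisymm (boundarySet_subset_of_dist_le (K := K) ?_)
          (boundarySet_subset_of_dist_le (K := K) ?_)
        · exact fun u hu => ⟨φ u, hu.2, hK u hu.1⟩
        · intro v hv
          obtain ⟨u, hu, rfl⟩ := hVsub hv
          exact ⟨u, ⟨hu, hv⟩, by rw [dist_comm]; exact hK u hu⟩
    refine subset_antisymm hVsub ?_
    rintro _ ⟨u, hu, rfl⟩
    rw [← hpre] at hu
    exact hu.2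


/-- Moving a minimal set a fixed proportion of the way towards another one yields a minimal
set. -/
theorem MinimalFullSub.image_seg (h₁ : MinimalFullSub X Y W₁) (h₂ : MinimalFullSub X Y W₂)
    (hY : (boundarySet Y).Nonempty) {δ : X → ℝ → X}
    (hδ : ∀ z, IsGeodesicSeg z (nearestPt W₂ z) (δ z)) {t : ℝ} (ht : t ∈ Set.Icc (0 : ℝ) 1) :
    MinimalFullSub X Y ((fun z => δ z t) '' W₁) := by
  have hne₁ := h₁.nonempty hY
  have hne₂ := h₂.nonempty hY
  obtain ⟨z₀, hz₀⟩ := hne₁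
  have hback : ∀ z ∈ W₁, nearestPt W₁ (δ z t) = z := by
    intro z hz
    refine eq_nearestPt h₁.1 h₁.2.1 hz ((Metric.le_infDist ⟨z, hz⟩).2 fun w hw => ?_)
    have e1 : dist z (nearestPt W₂ z) ≤ dist (nearestPt W₂ z) w := by
      rw [dist_nearestPt h₂.1 hne₂, h₁.infDist_symm h₂ hY hz (nearestPt_mem h₂.1 hne₂ z)]
      exact Metric.infDist_le_dist_of_mem hw
    have e2 := (hδ z).dist_left ht
    have e3 := (hδ z).dist_right ht
    have e4 := dist_triangle_left (nearestPt W₂ z) w (δ z t)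
    have e5 := dist_comm (δ z t) z
    linarith
  refine h₁.image (K := Metric.infDist z₀ W₂) (fun u hu v hv => le_antisymm ?_ ?_)
    fun u hu => ?_
  · have := (hδ u).dist_le (hδ v) ht
    rw [h₁.dist_nearestPt_nearestPt h₂ hY hu hv] at this
    linarith
  · have := dist_nearestPt_nearestPt_le h₁.1 h₁.2.1 ⟨z₀, hz₀⟩ (δ u t) (δ v t)
    rwa [hback u hu, hback v hv] at this
  · have e2 := (hδ u).dist_left ht
    rw [dist_nearestPt h₂.1 hne₂, h₁.infDist_eq h₂ hY hu hz₀] at e2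
    have := mul_le_mul_of_nonneg_right ht.2 (Metric.infDist_nonneg (x := z₀) (s := W₂))
    have e5 := dist_comm (δ u t) u
    linarith

theorem geoConvex_sUnion_minimalFullSub (hY : (boundarySet Y).Nonempty) :
    GeoConvex (⋃₀ {Z : Set X | MinimalFullSub X Y Z}) := by
  rintro x ⟨W₁, h₁, hx⟩ y ⟨W₂, h₂, hy⟩ γ hγ t ht
  have h₁' : MinimalFullSub X Y W₁ := h₁
  have h₂' : MinimalFullSub X Y W₂ := h₂
  choose δ hδ using fun z => CAT0Space.exists_geodesic z (nearestPt W₂ z)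
  refine ⟨_, h₁'.image_seg h₂' hY hδ ht, ?_⟩
  have hne₁ := h₁'.nonempty hY
  have hne₂ := h₂'.nonempty hY
  have hu := nearestPt_mem h₁'.1 hne₁ y
  obtain ⟨c, hc⟩ := CAT0Space.exists_geodesic x (nearestPt W₁ y)
  have hw := h₁'.2.1 x hx _ hu c hc t ht
  have hpu : nearestPt W₂ (nearestPt W₁ y) = y := h₂'.nearestPt_nearestPt h₁' hY hy
  have hpw := nearestPt_mem h₂'.1 hne₂ (c t)
  have hxy := h₂'.dist_sq_eq h₁' hY hy hx
  rw [h₂'.infDist_symm h₁' hY hy hx, dist_comm y x, dist_comm (nearestPt W₁ y) x] at hxy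
  have hwp : dist (c t) (nearestPt W₂ (c t)) = Metric.infDist x W₂ := by
    rw [dist_nearestPt h₂'.1 hne₂, h₁'.infDist_eq h₂' hY hw hx]
  have hcx := hc.dist_left ht
  have hcu := hc.dist_right ht
  refine ⟨c t, hw, hγ.eq_of_dist_le ht (abs_le_of_sq_le_sq' ?_ ?_).2
    (abs_le_of_sq_le_sq' ?_ ?_).2⟩
  · have h3 := CAT0Space.comparison x _ _ _ (hδ (c t)) t ht
    rw [h₁'.dist_sq_eq h₂' hY hx hpw, h₁'.dist_nearestPt_nearestPt h₂' hY hx hw, hwp, hcx] at h3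
    rw [dist_comm, mul_pow, hxy]
    linarith
  · exact mul_nonneg ht.1 dist_nonneg
  · have h3 := CAT0Space.comparison y _ _ _ (hδ (c t)) t ht
    have h4 := h₁'.dist_nearestPt_nearestPt h₂' hY hu hw
    rw [hpu, dist_comm _ (c t), hcu] at h4
    rw [h₂'.dist_sq_eq h₁' hY hy hw, h₂'.infDist_symm h₁' hY hy hx, hwp, h4,
      dist_comm _ (c t), hcu] at h3
    rw [dist_comm, mul_pow, hxy]
    linarith
  · exact mul_nonneg (sub_nonneg.2 ht.2) dist_nonneg

theorem isClosed_sUnion_minimalFullSub (hY : (boundarySet Y).Nonempty) :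
    IsClosed (⋃₀ {Z : Set X | MinimalFullSub X Y Z}) := by
  refine isClosed_of_closure_subset fun x hx => ?_
  obtain ⟨u, hu, hux⟩ := mem_closure_iff_seq_limit.1 hx
  choose W hW huW using hu
  replace hW : ∀ n, MinimalFullSub X Y (W n) := hW
  obtain ⟨V, hV⟩ : ∃ V, MinimalFullSub X Y V := ⟨W 0, hW 0⟩
  have hVne := hV.nonempty hY
  have hbd : ∀ z ∈ V, ∀ᶠ n in atTop, dist (nearestPt (W n) z) z ≤ dist (nearestPt V x) x + 1 := by
    intro z hz
    filter_upwards [Metric.tendsto_nhds.1 hux 1 one_pos] with n hn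
    rw [dist_comm, dist_nearestPt (hW n).1 ⟨_, huW n⟩,
      hV.infDist_eq (hW n) hY hz (nearestPt_mem hV.1 hVne x)]
    refine (Metric.infDist_le_dist_of_mem (huW n)).trans
      ((dist_triangle _ x _).trans (add_le_add_right ?_ _))
    rw [dist_comm]
    exact hn.le
  have hex : ∀ z, ∃ y, z ∈ V →
      Tendsto (fun n => nearestPt (W n) z) (hyperfilter ℕ : Filter ℕ) (nhds y) := by
    intro z
    by_cases hz : z ∈ V
    · obtain ⟨y, hy⟩ := exists_tendsto_hyperfilter_of_dist_le (hbd z hz)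
      exact ⟨y, fun _ => hy⟩
    · exact ⟨z, fun h => absurd h hz⟩
  choose φ hφ using hex
  have hle : (hyperfilter ℕ : Filter ℕ) ≤ atTop := Nat.hyperfilter_le_atTop
  have hφiso : ∀ z ∈ V, ∀ w ∈ V, dist (φ z) (φ w) = dist z w := by
    intro z hz w hw
    refine tendsto_nhds_unique ((hφ z hz).dist (hφ w hw)) ?_
    simp only [hV.dist_nearestPt_nearestPt (hW _) hY hz hw]
    exact tendsto_const_nhds
  have hφbd : ∀ z ∈ V, dist z (φ z) ≤ dist (nearestPt V x) x + 1 := by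
    intro z hz
    rw [dist_comm]
    exact le_of_tendsto ((hφ z hz).dist tendsto_const_nhds) ((hbd z hz).filter_mono hle)
  refine ⟨_, hV.image hφiso hφbd, nearestPt V x, nearestPt_mem hV.1 hVne x, ?_⟩
  refine tendsto_nhds_unique (hφ _ (nearestPt_mem hV.1 hVne x)) ?_
  refine tendsto_iff_dist_tendsto_zero.2 ?_
  have hux' : Tendsto (fun n => 2 * dist (u n) x) (hyperfilter ℕ : Filter ℕ) (nhds 0) := by
    simpa using ((tendsto_iff_dist_tendsto_zero.1 hux).const_mul 2).mono_left hle
  refine squeeze_zero (fun _ => dist_nonneg) (fun n => ?_) hux'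
  have h1 := dist_nearestPt_nearestPt_le (hW n).1 (hW n).2.1 ⟨_, huW n⟩
    (nearestPt V x) (nearestPt V (u n))
  rw [(hW n).nearestPt_nearestPt hV hY (huW n)] at h1
  have h2 := dist_nearestPt_nearestPt_le hV.1 hV.2.1 hVne x (u n)
  have h3 := dist_triangle (nearestPt (W n) (nearestPt V x)) (u n) x
  rw [dist_comm x] at h2
  linarith

/-- The squared distance between points of two minimal sets splits along a third minimal set. -/
theorem MinimalFullSub.dist_sq_eq_add (h₁ : MinimalFullSub X Y W₁) (h₂ : MinimalFullSub X Y W₂)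
    (h₃ : MinimalFullSub X Y W₃) (hY : (boundarySet Y).Nonempty) {x y z : X} (hx : x ∈ W₁)
    (hy : y ∈ W₂) (hz : z ∈ W₃) :
    dist x y ^ 2 = dist (nearestPt W₃ x) (nearestPt W₃ y) ^ 2 +
      dist (nearestPt W₁ z) (nearestPt W₂ z) ^ 2 := by
  have hne := h₂.nonempty hY
  rw [h₁.dist_sq_eq h₂ hY hx hy, ← h₃.nearestPt_nearestPt_eq h₁ h₂ hY hz, dist_nearestPt h₂.1 hne,
    h₁.infDist_eq h₂ hY (nearestPt_mem h₁.1 ⟨x, hx⟩ z) hx,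
    ← h₁.nearestPt_nearestPt_eq h₂ h₃ hY hx,
    h₂.dist_nearestPt_nearestPt h₃ hY (nearestPt_mem h₂.1 hne x) hy, add_comm]

/-- The union of the minimal sets is the product of a minimal set `Z` with the set of points
projecting to a given point of `Z`. -/
theorem MinimalFullSub.exists_isometryEquiv_prod {Z : Set X} (hZ : MinimalFullSub X Y Z)
    (hY : (boundarySet Y).Nonempty) :
    ∃ (Z' : Type u) (_ : MetricSpace Z')
      (φ : (⋃₀ {Z : Set X | MinimalFullSub X Y Z} : Set X) ≃ᵢ WithLp 2 (Z × Z')),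
      ∀ W : Set X, MinimalFullSub X Y W ↔
        ∃ z' : Z', W = Subtype.val ''
          ((⇑φ) ⁻¹' {q : WithLp 2 (Z × Z') | (WithLp.equiv 2 (Z × Z') q).2 = z'}) := by
  have hne := hZ.nonempty hY
  obtain ⟨z₀, hz₀⟩ := hne
  set U : Set X := ⋃₀ {Z : Set X | MinimalFullSub X Y Z}
  have hmem : ∀ x : U, ∃ W, MinimalFullSub X Y W ∧ (x : X) ∈ W := fun x => x.2
  choose F hF hxF using hmem
  have hF_eq : ∀ (x : U) {W : Set X}, MinimalFullSub X Y W → (x : X) ∈ W → F x = W :=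
    fun x W hW hx => (hF x).eq_of_mem hW hY (hxF x) hx
  have hfib : ∀ x : U, nearestPt (F x) z₀ ∈ {y | y ∈ U ∧ nearestPt Z y = z₀} := fun x =>
    ⟨⟨F x, hF x, nearestPt_mem (hF x).1 ⟨x, hxF x⟩ z₀⟩, hZ.nearestPt_nearestPt (hF x) hY hz₀⟩
  set Z' : Set X := {y | y ∈ U ∧ nearestPt Z y = z₀}
  have hproj : ∀ x : X, nearestPt Z x ∈ Z := nearestPt_mem hZ.1 ⟨z₀, hz₀⟩
  let f : U → WithLp 2 (Z × Z') := fun x =>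
    WithLp.toLp 2 (⟨nearestPt Z x, hproj x⟩, ⟨nearestPt (F x) z₀, hfib x⟩)
  have hiso : Isometry f := by
    refine Isometry.of_dist_eq fun x y => ?_
    rw [WithLp.prod_dist_eq_add (by norm_num)]
    have := (hF x).dist_sq_eq_add (hF y) hZ hY (hxF x) (hxF y) hz₀
    change (dist (nearestPt Z x) (nearestPt Z y) ^ (2 : ENNReal).toReal +
      dist (nearestPt (F x) z₀) (nearestPt (F y) z₀) ^ (2 : ENNReal).toReal) ^
        (1 / (2 : ENNReal).toReal) = dist (x : X) y
    rw [ENNReal.toReal_ofNat, Real.rpow_two, Real.rpow_two, ← this, ← Real.sqrt_eq_rpow,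
      Real.sqrt_sq dist_nonneg]
  have hsurj : Function.Surjective f := by
    rintro ⟨⟨z, hz⟩, ⟨w, hwU, hw⟩⟩
    have hFw := hF ⟨w, hwU⟩
    have hx := nearestPt_mem hFw.1 ⟨w, hxF ⟨w, hwU⟩⟩ z
    refine ⟨⟨nearestPt (F ⟨w, hwU⟩) z, _, hFw, hx⟩, ?_⟩
    have h1 : nearestPt Z (nearestPt (F ⟨w, hwU⟩) z) = z := hZ.nearestPt_nearestPt hFw hY hz
    have h2 : nearestPt (F ⟨w, hwU⟩) z₀ = w := by
      rw [← hw]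
      exact hFw.nearestPt_nearestPt hZ hY (hxF ⟨w, hwU⟩)
    have h3 := hF_eq ⟨nearestPt (F ⟨w, hwU⟩) z, _, hFw, hx⟩ hFw hx
    simp only [f, h1, h3, h2]
  have hfibre : ∀ z' : Z', F ⟨z', z'.2.1⟩ =
      Subtype.val '' (f ⁻¹' {q | (WithLp.equiv 2 (Z × Z') q).2 = z'}) := by
    rintro ⟨w, hwU, hw⟩
    have hFw := hF ⟨w, hwU⟩
    have h2 : nearestPt (F ⟨w, hwU⟩) z₀ = w := by
      rw [← hw]
      exact hFw.nearestPt_nearestPt hZ hY (hxF ⟨w, hwU⟩)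
    ext x
    constructor
    · intro hx
      refine ⟨⟨x, _, hFw, hx⟩, Subtype.ext ?_, rfl⟩
      change nearestPt (F ⟨x, _⟩) z₀ = w
      rw [hF_eq ⟨x, _, hFw, hx⟩ hFw hx, h2]
    · rintro ⟨x, hx, rfl⟩
      have hx' : nearestPt (F x) z₀ = w := congrArg Subtype.val hx
      have hwF : w ∈ F x := hx' ▸ nearestPt_mem (hF x).1 ⟨x, hxF x⟩ z₀
      rw [hF_eq ⟨w, hwU⟩ (hF x) hwF]
      exact hxF x
  refine ⟨Z', inferInstance,
    { Equiv.ofBijective f ⟨hiso.injective, hsurj⟩ with isometry_toFun := hiso }, fun W => ?_⟩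
  constructor
  · intro hW
    have hw := nearestPt_mem hW.1 (hW.nonempty hY) z₀
    let z' : Z' := ⟨nearestPt W z₀, ⟨W, hW, hw⟩, hZ.nearestPt_nearestPt hW hY hz₀⟩
    exact ⟨z', (hF_eq ⟨z', z'.2.1⟩ hW hw).symm.trans (hfibre z')⟩
  · rintro ⟨z', rfl⟩
    exact hfibre z' ▸ hF _

end Minimal

/-- existence of minimal closed convex subsets with prescribed full
boundary of large circumradius, and the product structure of their union. -/
theorem stmt5 (X : Type u) [MetricSpace X] [ProperSpace X] [CAT0Space X]
    (Y : Set X) (hYcl : IsClosed Y) (hYcv : GeoConvex Y)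
    (hrad : Real.pi / 2 <
      circumradiusIn titsAngle (boundarySet Y) (boundarySet Y)) :
    (∃ Z : Set X, MinimalFullSub X Y Z) ∧
    IsClosed (⋃₀ {Z : Set X | MinimalFullSub X Y Z}) ∧
    GeoConvex (⋃₀ {Z : Set X | MinimalFullSub X Y Z}) ∧
    ∃ (Z : Set X), MinimalFullSub X Y Z ∧
      ∃ (Z' : Type u) (_ : MetricSpace Z')
        (φ : (⋃₀ {Z : Set X | MinimalFullSub X Y Z} : Set X) ≃ᵢ WithLp 2 (Z × Z')),
        ∀ W : Set X, MinimalFullSub X Y W ↔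
          ∃ z' : Z', W = Subtype.val ''
            ((⇑φ) ⁻¹' {q : WithLp 2 (Z × Z') | (WithLp.equiv 2 (Z × Z') q).2 = z'}) := by
  have hY := boundarySet_nonempty_of_circumradius hrad
  obtain ⟨Z, hZ⟩ := exists_minimalFullSub hYcl hYcv hrad
  exact ⟨⟨Z, hZ⟩, isClosed_sUnion_minimalFullSub hY, geoConvex_sUnion_minimalFullSub hY, Z, hZ,
    hZ.exists_isometryEquiv_prod hY⟩
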